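/- arXiv:0711.3930 — 2 statements merged into one kernel-verified Lean document; each statement's English description precedes it below -/
import Mathlib

section
/- If (I,J,K) ∈ T̃ⁿ_r has property Pₙ (or the approximate property APₙ), then for all self-adjoint a, b in any finite von Neumann algebra (M,τ), the Horn inequality ∫_{ω_{σ(I)}} λ_a(t) dt + ∫_{ω_{σ(J)}} λ_b(t) dt ≥ ∫_{ω_K} λ_{a+b}(t) dt holds, where σ = σₙ is the order-reversing permutation i ↦ n+1−i. -/
open scoped ComplexOrder

namespace Paper

variable {H : Type} [NormedAddCommGroup H] [InnerProductSpace ℂ H] [CompleteSpace H]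

/-- `p` is an (orthogonal) projection operator. -/
def IsProj (p : H →L[ℂ] H) : Prop := IsIdempotentElem p ∧ IsSelfAdjoint p

/-- `p` is a projection belonging to the von Neumann algebra `M`. -/
def IsProjection (M : VonNeumannAlgebra H) (p : H →L[ℂ] H) : Prop :=
  p ∈ M ∧ IsProj p

/-- The range of an operator, as a submodule. -/
def rng (p : H →L[ℂ] H) : Submodule ℂ H := LinearMap.range p.toLinearMap

/-- `r` is the lattice meet `p ∧ q` of projections: the orthogonal projection onto `pH ∩ qH`. -/
def IsMeetOf (r p q : H →L[ℂ] H) : Prop := IsProj r ∧ rng r = rng p ⊓ rng q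

/-- `r` is the lattice join `p ∨ q` of projections:
the orthogonal projection onto the closure of `pH + qH`. -/
def IsJoinOf (r p q : H →L[ℂ] H) : Prop :=
  IsProj r ∧ rng r = (rng p ⊔ rng q).topologicalClosure

/-- A faithful tracial state on a von Neumann algebra, making it a finite von Neumann algebra. -/
structure TracialState (M : VonNeumannAlgebra H) where
  τ : (H →L[ℂ] H) → ℂ
  map_add : ∀ a b : H →L[ℂ] H, τ (a + b) = τ a + τ b
  map_smul : ∀ (c : ℂ) (a : H →L[ℂ] H), τ (c • a) = c * τ a
  tracial : ∀ a b : H →L[ℂ] H, a ∈ M → b ∈ M → τ (a * b) = τ (b * a)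
  pos : ∀ a : H →L[ℂ] H, a ∈ M → 0 ≤ τ (star a * a)
  faithful : ∀ a : H →L[ℂ] H, a ∈ M → τ (star a * a) = 0 → a = 0
  normalized : τ 1 = 1

/-- `M` is diffuse: it has no minimal nonzero projections. -/
def Diffuse (M : VonNeumannAlgebra H) : Prop :=
  ∀ p : H →L[ℂ] H, IsProjection M p → p ≠ 0 →
    ∃ q : H →L[ℂ] H, IsProjection M q ∧ rng q ≤ rng p ∧ q ≠ 0 ∧ q ≠ p

end Paper

namespace Paper

variable {H : Type} [NormedAddCommGroup H] [InnerProductSpace ℂ H] [CompleteSpace H]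

/-- A flag in `(M,τ)`: an increasing family `(e_t)_{0≤t≤1}` of projections with `τ(e_t) = t`. -/
def IsFlag (M : VonNeumannAlgebra H) (T : TracialState M) (e : ℝ → (H →L[ℂ] H)) : Prop :=
  (∀ t ∈ Set.Icc (0:ℝ) 1, IsProjection M (e t)) ∧
  (∀ s ∈ Set.Icc (0:ℝ) 1, ∀ t ∈ Set.Icc (0:ℝ) 1, s ≤ t → rng (e s) ≤ rng (e t)) ∧
  (∀ t ∈ Set.Icc (0:ℝ) 1, T.τ (e t) = ((t : ℝ) : ℂ))

/-- Property `Pₙ` for a triple of `r`-subsets of `{1,…,n}`, given by the indexing functions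
`i, j, k` (1-indexed, increasing): for all flags `e, f, g` in any finite von Neumann algebra
`(M,τ)` there is a projection `p` with `τ(p) = r/n` and
`τ(e_{i_ℓ/n} ∧ p) ≥ ℓ/n`, `τ(f_{j_ℓ/n} ∧ p) ≥ ℓ/n`, `τ(g_{k_ℓ/n} ∧ p) ≥ ℓ/n`
for all `ℓ ∈ {1,…,r}`. -/
def PropertyP (n r : ℕ) (i j k : ℕ → ℕ) : Prop :=
  ∀ (H' : Type) [NormedAddCommGroup H'] [InnerProductSpace ℂ H'] [CompleteSpace H']
    (M : VonNeumannAlgebra H') (T : TracialState M) (e f g : ℝ → (H' →L[ℂ] H')),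
    IsFlag M T e → IsFlag M T f → IsFlag M T g →
    ∃ p : H' →L[ℂ] H', IsProjection M p ∧ T.τ p = (((r : ℝ) / n : ℝ) : ℂ) ∧
      ∀ ℓ : ℕ, 1 ≤ ℓ → ℓ ≤ r →
        (∃ q, q ∈ M ∧ IsMeetOf q (e ((i ℓ : ℝ) / n)) p ∧ (((ℓ : ℝ) / n : ℝ) : ℂ) ≤ T.τ q) ∧
        (∃ q, q ∈ M ∧ IsMeetOf q (f ((j ℓ : ℝ) / n)) p ∧ (((ℓ : ℝ) / n : ℝ) : ℂ) ≤ T.τ q) ∧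
        (∃ q, q ∈ M ∧ IsMeetOf q (g ((k ℓ : ℝ) / n)) p ∧ (((ℓ : ℝ) / n : ℝ) : ℂ) ≤ T.τ q)

/-- Property `APₙ`: the approximate version of property `Pₙ`, where the projection `p`
satisfies `τ(p) ≤ r/n + ε` for a given `ε > 0`. -/
def PropertyAP (n r : ℕ) (i j k : ℕ → ℕ) : Prop :=
  ∀ (H' : Type) [NormedAddCommGroup H'] [InnerProductSpace ℂ H'] [CompleteSpace H']
    (M : VonNeumannAlgebra H') (T : TracialState M) (e f g : ℝ → (H' →L[ℂ] H')),
    IsFlag M T e → IsFlag M T f → IsFlag M T g →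
    ∀ ε : ℝ, 0 < ε →
    ∃ p : H' →L[ℂ] H', IsProjection M p ∧ T.τ p ≤ (((r : ℝ) / n + ε : ℝ) : ℂ) ∧
      ∀ ℓ : ℕ, 1 ≤ ℓ → ℓ ≤ r →
        (∃ q, q ∈ M ∧ IsMeetOf q (e ((i ℓ : ℝ) / n)) p ∧ (((ℓ : ℝ) / n : ℝ) : ℂ) ≤ T.τ q) ∧
        (∃ q, q ∈ M ∧ IsMeetOf q (f ((j ℓ : ℝ) / n)) p ∧ (((ℓ : ℝ) / n : ℝ) : ℂ) ≤ T.τ q) ∧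
        (∃ q, q ∈ M ∧ IsMeetOf q (g ((k ℓ : ℝ) / n)) p ∧ (((ℓ : ℝ) / n : ℝ) : ℂ) ≤ T.τ q)

end Paper

namespace Paper

/-- The `f`-th smallest element of the finset `I` (1-indexed), with the convention
`elem I 0 = 0`. -/
def elem (I : Finset ℕ) (f : ℕ) : ℕ :=
  if f = 0 then 0 else (I.sort (· ≤ ·)).getD (f - 1) 0

/-- A Littlewood–Richardson filling of `ν\λ` according to `μ`, for partitions `λ, μ, ν`
with at most `r` parts (1-indexed): nonnegative integers `(f k ℓ)_{1 ≤ k ≤ ℓ ≤ r}`, where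
`f k ℓ` is the number of `k`'s in row `ℓ`, subject to the row-sum, content, shape and
lattice-word conditions. -/
def IsFilling (r : ℕ) (lam mu nu : ℕ → ℕ) (f : ℕ → ℕ → ℕ) : Prop :=
  (∀ k ℓ : ℕ, (k < 1 ∨ ℓ < k ∨ r < ℓ) → f k ℓ = 0) ∧
  (∀ ℓ, 1 ≤ ℓ → ℓ ≤ r → lam ℓ + ∑ k ∈ Finset.Icc 1 ℓ, f k ℓ = nu ℓ) ∧
  (∀ k, 1 ≤ k → k ≤ r → (∑ ℓ ∈ Finset.Icc k r, f k ℓ) = mu k) ∧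
  (∀ p ℓ : ℕ, p < ℓ → ℓ < r →
    lam (ℓ + 1) + ∑ k ∈ Finset.Icc 1 (p + 1), f k (ℓ + 1) ≤
      lam ℓ + ∑ k ∈ Finset.Icc 1 p, f k ℓ) ∧
  (∀ k p : ℕ, 1 ≤ k → k ≤ p → p < r →
    (∑ ℓ ∈ Finset.Icc (k + 1) (p + 1), f (k + 1) ℓ) ≤ ∑ ℓ ∈ Finset.Icc k p, f k ℓ)

/-- The Littlewood–Richardson coefficient `c^ν_{λ,μ}`: the number of Littlewood–Richardson
fillings of `ν\λ` according to `μ`. -/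
noncomputable def LRcoeff (r : ℕ) (lam mu nu : ℕ → ℕ) : ℕ :=
  Nat.card {f : ℕ → ℕ → ℕ // IsFilling r lam mu nu f}

/-- `λ = ρ_r(σₙ(I))`: the `p`-th part is `n − r + p − i_p`. -/
def lamOf (n r : ℕ) (I : Finset ℕ) (p : ℕ) : ℕ :=
  if 1 ≤ p ∧ p ≤ r then n + p - r - elem I p else 0

/-- `ν = ρ_r(K)`: the `p`-th part is `k_{r+1−p} − (r+1−p)`. -/
def nuOf (r : ℕ) (K : Finset ℕ) (p : ℕ) : ℕ :=
  if 1 ≤ p ∧ p ≤ r then elem K (r + 1 - p) - (r + 1 - p) else 0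

/-- The Littlewood–Richardson coefficient `c⁽ⁿ⁾(I,J,K)` of a triple of `r`-element subsets of
`{1,…,n}`, namely `c^ν_{λ,μ}` with `λ = ρ_r(σₙ(I))`, `μ = ρ_r(σₙ(J))`, `ν = ρ_r(K)`. -/
noncomputable def cIJK (n : ℕ) (I J K : Finset ℕ) : ℕ :=
  LRcoeff I.card (lamOf n I.card I) (lamOf n I.card J) (nuOf I.card K)

/-- The set `Ũⁿ_r` of triples of `r`-subsets of `{1,…,n}` whose total element sum is
`r(4n−r+3)/2`. -/
def Utilde (n r : ℕ) : Set (Finset ℕ × Finset ℕ × Finset ℕ) :=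
  {t | t.1 ⊆ Finset.Icc 1 n ∧ t.2.1 ⊆ Finset.Icc 1 n ∧ t.2.2 ⊆ Finset.Icc 1 n ∧
       t.1.card = r ∧ t.2.1.card = r ∧ t.2.2.card = r ∧
       2 * ((∑ i ∈ t.1, i) + (∑ j ∈ t.2.1, j) + (∑ k ∈ t.2.2, k)) = r * (4 * n - r + 3)}

/-- Fuel-based auxiliary recursion for the symmetrized Horn sets `T̃ⁿ_r`. -/
def TtildeAux : ℕ → ℕ → ℕ → Set (Finset ℕ × Finset ℕ × Finset ℕ)
  | 0, n, r => Utilde n r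
  | fuel + 1, n, r =>
    {t ∈ Utilde n r | ∀ p : ℕ, 0 < p → p < r → ∀ s ∈ TtildeAux fuel r p,
      p * (4 * n - p + 3) ≤
        2 * ((∑ x ∈ s.1, elem t.1 x) + (∑ x ∈ s.2.1, elem t.2.1 x) +
             (∑ x ∈ s.2.2, elem t.2.2 x))}

/-- The symmetrized Horn set `T̃ⁿ_r`. -/
def Ttilde (n r : ℕ) : Set (Finset ℕ × Finset ℕ × Finset ℕ) := TtildeAux r n r

/-- The triple `(I,J,K)` is TT-reducible: there are `u,v,w ∈ {0,…,r}` with `u+v+w = r`,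
the gap conditions (`u = r` or `i_{u+1} − i_u ≥ 2`, etc.), and `i_u + j_v + k_w ≤ n − 1`
(with `i₀ = j₀ = k₀ = 0`). -/
def TTReducible (n r : ℕ) (t : Finset ℕ × Finset ℕ × Finset ℕ) : Prop :=
  ∃ u v w : ℕ, u ≤ r ∧ v ≤ r ∧ w ≤ r ∧ u + v + w = r ∧
    (u = r ∨ elem t.1 u + 2 ≤ elem t.1 (u + 1)) ∧
    (v = r ∨ elem t.2.1 v + 2 ≤ elem t.2.1 (v + 1)) ∧
    (w = r ∨ elem t.2.2 w + 2 ≤ elem t.2.2 (w + 1)) ∧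
    elem t.1 u + elem t.2.1 v + elem t.2.2 w ≤ n - 1

end Paper

namespace Paper

/-- The eigenvalue function of a spectral distribution `μ`:
`λ(t) = sup { x ∈ ℝ ∣ μ((x,∞)) > t }`. -/
noncomputable def eigFn (μ : MeasureTheory.Measure ℝ) (t : ℝ) : ℝ :=
  sSup {x : ℝ | t < (μ (Set.Ioi x)).toReal}

/-- `ω_S = ⋃_{i ∈ S} [(i−1)/n, i/n)`. -/
def omegaSet (n : ℕ) (S : Finset ℕ) : Set ℝ :=
  ⋃ i ∈ S, Set.Ico (((i : ℝ) - 1) / n) ((i : ℝ) / n)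

end Paper

namespace PositiveLinearMap

open UniformSpace UniformSpace.Completion

variable {A : Type} [CStarAlgebra A] [PartialOrder A] [StarOrderedRing A] (f : A →ₚ[ℂ] ℂ)

/-- The image of an element of the algebra in the GNS Hilbert space. -/
noncomputable def gnsVec (x : A) : f.GNS := ((f.toPreGNS x : f.PreGNS) : f.GNS)

lemma gnsStarAlgHom_gnsVec (a x : A) :
    f.gnsStarAlgHom a (f.gnsVec x) = f.gnsVec (a * x) := by
  simp [gnsVec, gnsStarAlgHom]

lemma inner_gnsVec (x y : A) : inner ℂ (f.gnsVec x) (f.gnsVec y) = f (star x * y) := by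
  simp [gnsVec, preGNS_inner_def]

lemma denseRange_gnsVec : DenseRange f.gnsVec :=
  (Completion.denseRange_coe (α := f.PreGNS)).comp f.toPreGNS.surjective.denseRange
    (Completion.continuous_coe _)

variable (htr : ∀ x y, f (x * y) = f (y * x))

/-- The conjugation `x ↦ x*` on the pre-GNS space of a tracial functional. -/
noncomputable def preConj : f.PreGNS →SL[starRingEnd ℂ] f.PreGNS :=
  LinearMap.mkContinuous
    { toFun := fun x => f.toPreGNS (star (f.ofPreGNS x))
      map_add' := by simp
      map_smul' := by simp } 1 (fun x => by
        apply le_of_eq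
        rw [one_mul, preGNS_norm_def, preGNS_norm_def]
        simp [htr])

/-- The conjugation on the GNS space of a tracial functional. -/
noncomputable def conjGNS : f.GNS →SL[starRingEnd ℂ] f.GNS := (f.preConj htr).completion

lemma conjGNS_gnsVec (x : A) : f.conjGNS htr (f.gnsVec x) = f.gnsVec (star x) := by
  simp [conjGNS, gnsVec, preConj]

lemma conjGNS_conjGNS (v : f.GNS) : f.conjGNS htr (f.conjGNS htr v) = v := by
  refine f.denseRange_gnsVec.induction_on v ?_ ?_
  · exact isClosed_eq (by fun_prop) (by fun_prop)
  · intro x; simp [conjGNS_gnsVec]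

lemma inner_conjGNS (v w : f.GNS) :
    inner ℂ (f.conjGNS htr v) (f.conjGNS htr w) = inner ℂ w v := by
  refine f.denseRange_gnsVec.induction_on₂ ?_ ?_ v w
  · exact isClosed_eq (by fun_prop) (by fun_prop)
  · intro x y; simp [conjGNS_gnsVec, inner_gnsVec, htr x]

/-- Right multiplication on the GNS space of a tracial functional. -/
noncomputable def rightMul (x : A) : f.GNS →L[ℂ] f.GNS :=
  (f.conjGNS htr).comp ((f.gnsStarAlgHom (star x)).comp (f.conjGNS htr))

lemma rightMul_gnsVec (x y : A) : f.rightMul htr x (f.gnsVec y) = f.gnsVec (y * x) := by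
  simp [rightMul, conjGNS_gnsVec, gnsStarAlgHom_gnsVec, -gnsStarAlgHom_apply]

lemma inner_rightMul (x : A) (v w : f.GNS) :
    inner ℂ (f.rightMul htr x v) w = inner ℂ v (f.rightMul htr (star x) w) := by
  refine f.denseRange_gnsVec.induction_on₂ ?_ ?_ v w
  · exact isClosed_eq (by fun_prop) (by fun_prop)
  · intro y z
    simp only [rightMul_gnsVec, inner_gnsVec, star_mul]
    rw [mul_assoc, htr, mul_assoc]

/-- The von Neumann algebra of operators commuting with all right multiplications. -/
noncomputable def gnsVN : VonNeumannAlgebra f.GNS where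
  toStarSubalgebra := StarSubalgebra.centralizer ℂ (Set.range (f.rightMul htr))
  centralizer_centralizer' := by
    simp

lemma mem_gnsVN {y : f.GNS →L[ℂ] f.GNS} :
    y ∈ f.gnsVN htr ↔ ∀ x v, y (f.rightMul htr x v) = f.rightMul htr x (y v) := by
  have h : y ∈ f.gnsVN htr ↔ y ∈ StarSubalgebra.centralizer ℂ (Set.range (f.rightMul htr)) :=
    Iff.rfl
  have hs : ∀ x, star (f.rightMul htr x) = f.rightMul htr (star x) := by
    intro x
    rw [ContinuousLinearMap.star_eq_adjoint, eq_comm, ContinuousLinearMap.eq_adjoint_iff]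
    intro v w
    rw [inner_rightMul, star_star]
  rw [h, StarSubalgebra.mem_centralizer_iff]
  simp only [Set.forall_mem_range, hs]
  constructor
  · intro H x v
    exact (DFunLike.congr_fun (H x).1 v).symm
  · intro H x
    exact ⟨by ext v; exact (H x v).symm, by ext v; exact (H _ v).symm⟩

lemma gnsStarAlgHom_mem_gnsVN (a : A) : f.gnsStarAlgHom a ∈ f.gnsVN htr := by
  rw [mem_gnsVN]
  intro x v
  refine f.denseRange_gnsVec.induction_on v ?_ ?_
  · exact isClosed_eq (by fun_prop) (by fun_prop)
  · intro y
    simp [rightMul_gnsVec, gnsStarAlgHom_gnsVec, -gnsStarAlgHom_apply, mul_assoc]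

lemma apply_gnsVec_of_mem {y : f.GNS →L[ℂ] f.GNS} (hy : y ∈ f.gnsVN htr) (x : A) :
    y (f.gnsVec x) = f.rightMul htr x (y (f.gnsVec 1)) := by
  rw [← (f.mem_gnsVN htr).1 hy, rightMul_gnsVec, one_mul]

lemma conjGNS_apply_one {y : f.GNS →L[ℂ] f.GNS} (hy : y ∈ f.gnsVN htr) :
    f.conjGNS htr (y (f.gnsVec 1)) = star y (f.gnsVec 1) := by
  have key : ∀ x, inner ℂ (f.conjGNS htr (y (f.gnsVec 1))) (f.gnsVec x) =
      inner ℂ (star y (f.gnsVec 1)) (f.gnsVec x) := by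
    intro x
    rw [ContinuousLinearMap.star_eq_adjoint, ContinuousLinearMap.adjoint_inner_left,
      f.apply_gnsVec_of_mem htr hy x]
    conv_rhs => rw [← star_star x]
    rw [← inner_rightMul, rightMul_gnsVec, one_mul, ← inner_conjGNS f htr, conjGNS_gnsVec,
      conjGNS_conjGNS]
  refine ext_inner_right ℂ fun w => ?_
  refine f.denseRange_gnsVec.induction_on w ?_ key
  exact isClosed_eq (by fun_prop) (by fun_prop)

/-- The vector state of the cyclic vector is a faithful trace on `gnsVN`. -/
noncomputable def gnsTrace (h1 : f 1 = 1) : Paper.TracialState (f.gnsVN htr) where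
  τ y := inner ℂ (f.gnsVec 1) (y (f.gnsVec 1))
  map_add := by simp [inner_add_right]
  map_smul := by simp [inner_smul_right]
  tracial a b ha hb := by
    have h : ∀ a b : f.GNS →L[ℂ] f.GNS, inner ℂ (f.gnsVec 1) ((a * b) (f.gnsVec 1)) =
        inner ℂ (star a (f.gnsVec 1)) (b (f.gnsVec 1)) := by
      intro a b
      rw [ContinuousLinearMap.star_eq_adjoint, ContinuousLinearMap.adjoint_inner_left]; rfl
    rw [h, h, ← f.conjGNS_apply_one htr ha, ← f.conjGNS_apply_one htr hb, ← inner_conjGNS f htr,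
      conjGNS_conjGNS]
  pos a _ := by
    rw [ContinuousLinearMap.star_eq_adjoint, mul_apply_eq_comp,
      ContinuousLinearMap.adjoint_inner_right]
    rw [inner_self_eq_norm_sq_to_K]
    positivity
  faithful a ha h := by
    rw [ContinuousLinearMap.star_eq_adjoint, mul_apply_eq_comp,
      ContinuousLinearMap.adjoint_inner_right, inner_self_eq_zero] at h
    ext v
    refine f.denseRange_gnsVec.induction_on v ?_ ?_
    · exact isClosed_eq (by fun_prop) (by fun_prop)
    · intro x; rw [f.apply_gnsVec_of_mem htr ha, h]; simp
  normalized := by rw [one_apply_eq_self, inner_gnsVec, star_one, one_mul, h1]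

end PositiveLinearMap

namespace Paper

open MeasureTheory Filter Topology

/-- A tracial state on a C*-algebra extends, via the GNS construction, to a tracial vector state
on a von Neumann algebra. -/
theorem exists_gns (A : Type) [CStarAlgebra A] (φ : A →ₗ[ℂ] ℂ)
    (hpos : ∀ x, 0 ≤ φ (star x * x)) (htr : ∀ x y, φ (x * y) = φ (y * x)) (h1 : φ 1 = 1) :
    ∃ (H : Type) (_ : NormedAddCommGroup H) (_ : InnerProductSpace ℂ H) (_ : CompleteSpace H)
      (M : VonNeumannAlgebra H) (T : TracialState M) (π : A →⋆ₐ[ℂ] (H →L[ℂ] H)) (Ω : H),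
      (∀ x, π x ∈ M) ∧ (∀ x, T.τ (π x) = φ x) ∧ ∀ y, T.τ y = inner ℂ Ω (y Ω) := by
  let _ := CStarAlgebra.spectralOrder A
  have _ := CStarAlgebra.spectralOrderedRing A
  let f : A →ₚ[ℂ] ℂ := PositiveLinearMap.mk₀ φ (by
    intro x hx
    obtain ⟨y, rfl⟩ := CStarAlgebra.nonneg_iff_eq_star_mul_self.1 hx
    exact hpos y)
  have hf : ∀ x, f x = φ x := fun x => rfl
  refine ⟨f.GNS, inferInstance, inferInstance, inferInstance, f.gnsVN htr, f.gnsTrace htr h1,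
    f.gnsStarAlgHom, f.gnsVec 1, fun x => f.gnsStarAlgHom_mem_gnsVN htr x, fun x => ?_,
    fun y => rfl⟩
  change inner ℂ (f.gnsVec 1) (f.gnsStarAlgHom x (f.gnsVec 1)) = _
  rw [f.gnsStarAlgHom_gnsVec, f.inner_gnsVec]
  simp [hf]

/-- Tensoring a tracial C*-algebra with the unit interval and passing to the GNS representation. -/
theorem exists_gns_unitInterval (A : Type) [CStarAlgebra A] (φ : A →ₗ[ℂ] ℂ)
    (hpos : ∀ x, 0 ≤ φ (star x * x)) (htr : ∀ x y, φ (x * y) = φ (y * x)) (h1 : φ 1 = 1) :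
    ∃ (H : Type) (_ : NormedAddCommGroup H) (_ : InnerProductSpace ℂ H) (_ : CompleteSpace H)
      (M : VonNeumannAlgebra H) (T : TracialState M) (π : C(unitInterval, A) →⋆ₐ[ℂ] (H →L[ℂ] H))
      (Ω : H),
      (∀ x, π x ∈ M) ∧ (∀ x, T.τ (π x) = ∫ t, φ (x t)) ∧ ∀ y, T.τ y = inner ℂ Ω (y Ω) := by
  have hφ : Continuous φ := by
    let _ := CStarAlgebra.spectralOrder A
    have _ := CStarAlgebra.spectralOrderedRing A
    let f : A →ₚ[ℂ] ℂ := PositiveLinearMap.mk₀ φ (by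
      intro x hx
      obtain ⟨y, rfl⟩ := CStarAlgebra.nonneg_iff_eq_star_mul_self.1 hx
      exact hpos y)
    exact map_continuous f
  have hI : ∀ x : C(unitInterval, A), Integrable (fun t => φ (x t)) := fun x =>
    (hφ.comp x.continuous).integrable_of_hasCompactSupport (HasCompactSupport.of_compactSpace _)
  let ψ : C(unitInterval, A) →ₗ[ℂ] ℂ :=
    { toFun := fun x => ∫ t, φ (x t)
      map_add' := fun x y => by simp [integral_add (hI x) (hI y)]
      map_smul' := fun c x => by simp [integral_const_mul] }
  obtain ⟨H, i1, i2, i3, M, T, π, Ω, h1, h2, h3⟩ := exists_gns C(unitInterval, A) ψ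
    (fun x => integral_nonneg fun t => hpos (x t))
    (fun x y => integral_congr_ae (.of_forall fun t => htr (x t) (y t)))
    (by simp [ψ, h1])
  exact ⟨H, i1, i2, i3, M, T, π, Ω, h1, h2, h3⟩

/-- The coordinate function of the unit interval, as an element of `C([0,1], A)`. -/
noncomputable def coordFn (A : Type) [CStarAlgebra A] : C(unitInterval, A) :=
  ⟨fun t => ((t : ℝ) : ℂ) • (1 : A), by fun_prop⟩

lemma norm_coordFn_le (A : Type) [CStarAlgebra A] : ‖coordFn A‖ ≤ 1 := by
  refine (ContinuousMap.norm_le _ zero_le_one).2 fun t => ?_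
  rcases subsingleton_or_nontrivial A with h | h
  · rw [Subsingleton.elim (coordFn A t) 0]; simp
  · have h : |(t : ℝ)| ≤ 1 := abs_le.2 ⟨by linarith [t.2.1], t.2.2⟩
    simpa [coordFn, norm_smul] using h

/-- The law of `X + δ U` for independent `X ~ μ` and `U` uniform on `[0,1]`. -/
noncomputable def smear (μ : Measure ℝ) (δ : ℝ) : Measure ℝ :=
  (μ.prod (volume : Measure unitInterval)).map (fun z => z.1 + δ * z.2)

lemma measurable_smear_aux (δ : ℝ) :
    Measurable (fun z : ℝ × unitInterval => z.1 + δ * (z.2 : ℝ)) := by fun_prop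

instance (μ : Measure ℝ) [IsProbabilityMeasure μ] (δ : ℝ) : IsProbabilityMeasure (smear μ δ) :=
  Measure.isProbabilityMeasure_map (measurable_smear_aux δ).aemeasurable

lemma integrable_pow_of_support {μ : Measure ℝ} [IsProbabilityMeasure μ] {R : ℝ}
    (hR : μ (Set.Icc (-R) R)ᶜ = 0) (k : ℕ) : Integrable (fun x : ℝ => x ^ k) μ := by
  refine Integrable.of_bound (by fun_prop) (R ^ k) ?_
  have : ∀ᵐ x ∂μ, x ∈ Set.Icc (-R) R := hR
  filter_upwards [this] with x hx
  rw [norm_pow]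
  exact pow_le_pow_left₀ (norm_nonneg _) (abs_le.2 hx) k

lemma smear_support {μ : Measure ℝ} [IsProbabilityMeasure μ] {R δ : ℝ}
    (hR : μ (Set.Icc (-R) R)ᶜ = 0) (hδ : 0 ≤ δ) :
    smear μ δ (Set.Icc (-(R + δ)) (R + δ))ᶜ = 0 := by
  rw [smear, Measure.map_apply (measurable_smear_aux δ) measurableSet_Icc.compl]
  refine measure_mono_null (t := (Set.Icc (-R) R)ᶜ ×ˢ Set.univ) ?_ ?_
  · rintro ⟨x, t⟩ hx
    simp only [Set.mem_prod, Set.mem_univ, and_true, Set.mem_compl_iff, Set.mem_Icc,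
      Set.mem_preimage] at hx ⊢
    contrapose! hx
    have := t.2.1
    have := mul_nonneg hδ t.2.1
    have := mul_le_mul_of_nonneg_left t.2.2 hδ
    constructor <;> linarith
  · simp [Measure.prod_prod, hR]

/-- The moments of `a + δ t`. -/
lemma integral_pow_shift {A : Type} [CStarAlgebra A] (φ : A →ₗ[ℂ] ℂ) (h1 : φ 1 = 1) (a : A)
    {μ : Measure ℝ} [IsProbabilityMeasure μ] (hs : ∃ R : ℝ, μ (Set.Icc (-R) R)ᶜ = 0)
    (hm : ∀ k : ℕ, 1 ≤ k → φ (a ^ k) = ((∫ x, x ^ k ∂μ : ℝ) : ℂ)) {δ : ℝ} (hδ : 0 ≤ δ) (k : ℕ) :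
    ∫ t, φ (((ContinuousMap.const unitInterval a + (δ : ℂ) • coordFn A) ^ k) t) =
      ((∫ x, x ^ k ∂(smear μ δ) : ℝ) : ℂ) := by
  obtain ⟨R, hR⟩ := hs
  have hm' : ∀ k : ℕ, φ (a ^ k) = ((∫ x, x ^ k ∂μ : ℝ) : ℂ) := by
    intro k
    rcases Nat.eq_zero_or_pos k with rfl | hk
    · simp [h1]
    · exact hm k hk
  have hpt : ∀ t : unitInterval,
      φ (((ContinuousMap.const unitInterval a + (δ : ℂ) • coordFn A) ^ k) t) =
        ((∫ x, (x + δ * (t : ℝ)) ^ k ∂μ : ℝ) : ℂ) := by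
    intro t
    have e1 : ((ContinuousMap.const unitInterval a + (δ : ℂ) • coordFn A) ^ k) t =
        (a + ((δ : ℂ) * ((t : ℝ) : ℂ)) • (1 : A)) ^ k := by
      change (a + (δ : ℂ) • ((t : ℝ) : ℂ) • (1 : A)) ^ k = _
      rw [smul_smul]
    have e2 : ∀ x : ℝ, (x + δ * (t : ℝ)) ^ k =
        ∑ m ∈ Finset.range (k + 1), ((δ * t) ^ (k - m) * (k.choose m)) * x ^ m := by
      intro x; rw [add_pow]; exact Finset.sum_congr rfl fun m _ => by ring
    rw [e1, Commute.add_pow ((Commute.one_right a).smul_right _)]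
    simp only [e2]
    rw [integral_finsetSum _ fun m _ => (integrable_pow_of_support hR m).const_mul _]
    simp only [integral_const_mul, map_sum, Complex.ofReal_sum]
    refine Finset.sum_congr rfl fun m _ => ?_
    rw [smul_pow, one_pow, mul_smul_comm, mul_one, smul_mul_assoc, map_smul,
      ← nsmul_eq_mul', map_nsmul, hm']
    simp
    ring
  have hI : Integrable (fun z : ℝ × unitInterval => (z.1 + δ * (z.2 : ℝ)) ^ k)
      (μ.prod volume) := by
    have := integrable_pow_of_support (μ := smear μ δ) (smear_support hR hδ) k
    exact (integrable_map_measure (f := fun z : ℝ × unitInterval => z.1 + δ * (z.2 : ℝ))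
      (g := fun x : ℝ => x ^ k) (by fun_prop) (measurable_smear_aux δ).aemeasurable).1 this
  simp_rw [hpt]
  rw [integral_complex_ofReal, smear, integral_map (measurable_smear_aux δ).aemeasurable (by fun_prop),
    integral_prod_symm _ hI]

variable {H : Type} [NormedAddCommGroup H] [InnerProductSpace ℂ H] [CompleteSpace H]

lemma cfc_mem_vonNeumannAlgebra (M : VonNeumannAlgebra H) {X : H →L[ℂ] H} (hX : X ∈ M)
    (f : ℝ → ℝ) : cfc f X ∈ M := by
  rw [← M.commutant_commutant, VonNeumannAlgebra.mem_commutant_iff]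
  intro y hy
  have h : Commute X y := (VonNeumannAlgebra.mem_commutant_iff.1 hy X hX)
  exact (h.cfc_real f).symm.eq

lemma norm_sq_apply_of_isSelfAdjoint {B : H →L[ℂ] H} (hB : IsSelfAdjoint B) (v : H) :
    ‖B v‖ ^ 2 = (inner ℂ v ((B ^ 2) v)).re := by
  rw [pow_two B, mul_apply_eq_comp, ← ContinuousLinearMap.adjoint_inner_left,
    ← ContinuousLinearMap.star_eq_adjoint, hB.star_eq, inner_self_eq_norm_sq_to_K]
  norm_cast

lemma cfc_apply_eq_zero {X : H →L[ℂ] H} (hX : IsSelfAdjoint X) {f u : ℝ → ℝ}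
    (hf : Continuous f) (hu : Continuous u) (C : ℝ) (h : ∀ s, |f s| ≤ C * |u s|) {v : H}
    (hv : cfc u X v = 0) : cfc f X v = 0 := by
  set k : ℝ → ℝ := fun s => √((C * u s) ^ 2 - f s ^ 2) with hk
  have hkc : Continuous k := by fun_prop
  have hsum : cfc (fun s => C * u s) X ^ 2 = cfc f X ^ 2 + cfc k X ^ 2 := by
    rw [← cfc_pow _ 2 X, ← cfc_pow _ 2 X, ← cfc_pow _ 2 X, ← cfc_add X _ _]
    congr 1
    ext s
    have h0 : 0 ≤ (C * u s) ^ 2 - f s ^ 2 := by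
      rw [sub_nonneg]
      apply sq_le_sq.2
      refine (h s).trans ?_
      rw [abs_mul]
      exact mul_le_mul_of_nonneg_right (le_abs_self C) (abs_nonneg _)
    simp only [hk, Real.sq_sqrt h0]
    ring
  have h1 := norm_sq_apply_of_isSelfAdjoint (cfc_predicate (fun s => C * u s) X) v
  have h2 := norm_sq_apply_of_isSelfAdjoint (cfc_predicate f X) v
  have h3 := norm_sq_apply_of_isSelfAdjoint (cfc_predicate k X) v
  have h4 : cfc (fun s => C * u s) X v = 0 := by
    rw [cfc_const_mul C u X]
    simp [hv]
  rw [hsum, h4, add_apply, inner_add_right, Complex.add_re, ← h2, ← h3] at h1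
  have : ‖cfc f X v‖ ^ 2 = 0 := by
    have := sq_nonneg ‖cfc f X v‖
    have := sq_nonneg ‖cfc k X v‖
    simp at h1
    linarith
  simpa using this

/-- A continuous function which is `1` exactly on `(-∞, x]`. -/
def ramp (x s : ℝ) : ℝ := max 0 (min 1 (1 - (s - x)))

lemma continuous_ramp (x : ℝ) : Continuous (ramp x) := by unfold ramp; fun_prop

lemma ramp_nonneg (x s : ℝ) : 0 ≤ ramp x s := le_max_left _ _

lemma ramp_le_one (x s : ℝ) : ramp x s ≤ 1 := max_le zero_le_one (min_le_left _ _)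

lemma one_sub_ramp (x s : ℝ) : 1 - ramp x s = min 1 (max 0 (s - x)) := by
  unfold ramp
  rcases le_total (s - x) 0 with h | h
  · rw [max_eq_left h, min_eq_left (by linarith : (1 : ℝ) ≤ 1 - (s - x))]; norm_num
  · rw [max_eq_right h, min_eq_right (by linarith : 1 - (s - x) ≤ (1 : ℝ))]
    rcases le_total (s - x) 1 with h' | h'
    · rw [max_eq_right (by linarith), min_eq_right h']; ring
    · rw [max_eq_left (by linarith), min_eq_left h']; ring

/-- The spectral projection of `X` for the half-line `(-∞, x]`. -/
noncomputable def specProj (X : H →L[ℂ] H) (x : ℝ) : H →L[ℂ] H :=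
  ((cfc (ramp x) X).eqLocus (1 : H →L[ℂ] H)).starProjection

lemma isProj_specProj (X : H →L[ℂ] H) (x : ℝ) : IsProj (specProj X x) := by
  have h : IsStarProjection (specProj X x) := isStarProjection_starProjection
  exact ⟨h.isIdempotentElem, h.isSelfAdjoint⟩

lemma mem_rng_specProj {X : H →L[ℂ] H} {x : ℝ} {v : H} :
    v ∈ rng (specProj X x) ↔ cfc (ramp x) X v = v := by
  rw [rng, specProj]
  erw [Submodule.range_starProjection]
  rfl

lemma specProj_mem (M : VonNeumannAlgebra H) {X : H →L[ℂ] H} (hX : X ∈ M) (x : ℝ) :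
    specProj X x ∈ M := by
  have h : IsStarProjection (specProj X x) := isStarProjection_starProjection
  rw [VonNeumannAlgebra.IsStarProjection.mem_iff h M]
  intro y hy v hv
  have hv' := mem_rng_specProj.1 hv
  refine mem_rng_specProj.2 ?_
  have hc := VonNeumannAlgebra.mem_commutant_iff.1 hy _ (cfc_mem_vonNeumannAlgebra M hX (ramp x))
  have := DFunLike.congr_fun hc v
  simp only [mul_apply_eq_comp] at this
  change cfc (ramp x) X (y v) = y v
  rw [this, hv']

lemma isProjection_specProj (M : VonNeumannAlgebra H) {X : H →L[ℂ] H} (hX : X ∈ M) (x : ℝ) :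
    IsProjection M (specProj X x) := ⟨specProj_mem M hX x, isProj_specProj X x⟩

lemma cfc_one_sub_ramp_apply {X : H →L[ℂ] H} (hX : IsSelfAdjoint X) {x : ℝ} {v : H} :
    cfc (fun s => 1 - ramp x s) X v = 0 ↔ v ∈ rng (specProj X x) := by
  have hc := continuous_ramp x
  rw [cfc_sub (fun _ => 1) (ramp x) X, cfc_const_one ℝ X, mem_rng_specProj]
  rw [sub_apply, one_apply_eq_self, sub_eq_zero, eq_comm]

lemma cfc_mul_specProj {X : H →L[ℂ] H} (hX : IsSelfAdjoint X) {x : ℝ} {f : ℝ → ℝ}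
    (hf : Continuous f) (C : ℝ) (h : ∀ s, |f s| ≤ C * |1 - ramp x s|) :
    cfc f X * specProj X x = 0 := by
  ext v
  have hc := continuous_ramp x
  refine cfc_apply_eq_zero hX hf (u := fun s => 1 - ramp x s) (by fun_prop) C h ?_
  exact (cfc_one_sub_ramp_apply hX).2 ⟨v, rfl⟩

lemma rng_specProj_mono {X : H →L[ℂ] H} (hX : IsSelfAdjoint X) {x y : ℝ} (hxy : x ≤ y) :
    rng (specProj X x) ≤ rng (specProj X y) := by
  intro v hv
  rw [← cfc_one_sub_ramp_apply hX] at hv ⊢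
  have hcx := continuous_ramp x
  have hcy := continuous_ramp y
  refine cfc_apply_eq_zero hX (by fun_prop) (by fun_prop) 1 (fun s => ?_) hv
  have hx := ramp_le_one x s
  have hy := ramp_le_one y s
  rw [one_mul, abs_of_nonneg (by linarith), abs_of_nonneg (by linarith), one_sub_ramp,
    one_sub_ramp]
  gcongr

/-- The vector-state trace of a projection onto a fixed space is the limit of the traces of the
powers. -/
lemma re_inner_specProj {X : H →L[ℂ] H} {x : ℝ} {Ω : H} {l : ℝ}
    (hl : Tendsto (fun k : ℕ => (inner ℂ Ω ((cfc (ramp x) X ^ k) Ω)).re) atTop (𝓝 l)) :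
    (inner ℂ Ω (specProj X x Ω)).re = l := by
  have hn : ‖cfc (ramp x) X‖ ≤ 1 := norm_cfc_le zero_le_one fun s _ => by
    rw [Real.norm_eq_abs, abs_of_nonneg (ramp_nonneg x s)]; exact ramp_le_one x s
  have h1 := (cfc (ramp x) X).tendsto_birkhoffAverage_orthogonalProjection hn Ω
  have h2 : Tendsto (fun N : ℕ => (inner ℂ Ω (birkhoffAverage ℂ (⇑(cfc (ramp x) X : H →L[ℂ] H)) id N Ω)).re)
      atTop (𝓝 (inner ℂ Ω (specProj X x Ω)).re) :=
    (Complex.continuous_re.tendsto _).comp (tendsto_const_nhds.inner h1)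
  refine tendsto_nhds_unique h2 ?_
  convert hl.cesaro using 2 with N
  rw [birkhoffAverage, birkhoffSum, inner_smul_right, inner_sum]
  have : ((N : ℂ)⁻¹) = (((N : ℝ)⁻¹ : ℝ) : ℂ) := by push_cast; rfl
  rw [this, Complex.re_ofReal_mul, Complex.re_sum]
  simp

variable {M : VonNeumannAlgebra H}

/-- The real functional `y ↦ Re τ(p y)`. -/
noncomputable def TracialState.reTr (T : TracialState M) (p : H →L[ℂ] H) :
    (H →L[ℂ] H) →ₗ[ℝ] ℝ where
  toFun y := (T.τ (p * y)).re
  map_add' x y := by rw [mul_add, T.map_add, Complex.add_re]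
  map_smul' c x := by
    rw [mul_smul_comm, ← Complex.coe_smul, T.map_smul, Complex.re_ofReal_mul]
    rfl

lemma TracialState.reTr_apply (T : TracialState M) (p y : H →L[ℂ] H) :
    T.reTr p y = (T.τ (p * y)).re := rfl

lemma TracialState.reTr_one (T : TracialState M) (p : H →L[ℂ] H) :
    T.reTr p 1 = (T.τ p).re := by rw [T.reTr_apply, mul_one]

lemma TracialState.map_zero (T : TracialState M) : T.τ 0 = 0 := by
  simpa using T.map_smul 0 0

lemma TracialState.map_sub (T : TracialState M) (x y : H →L[ℂ] H) :
    T.τ (x - y) = T.τ x - T.τ y := by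
  rw [sub_eq_add_neg, T.map_add, ← neg_one_smul ℂ y, T.map_smul]; ring

lemma TracialState.nontrivial (T : TracialState M) : Nontrivial H := by
  by_contra h
  rw [not_nontrivial_iff_subsingleton] at h
  have h1 := T.normalized
  rw [Subsingleton.elim (1 : H →L[ℂ] H) 0, T.map_zero] at h1
  exact zero_ne_one h1

lemma TracialState.reTr_star_mul_self_nonneg (T : TracialState M) {p k : H →L[ℂ] H}
    (hp : IsProjection M p) (hk : k ∈ M) : 0 ≤ T.reTr p (star k * k) := by
  have h := T.pos (k * p) (mul_mem hk hp.1)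
  have he : T.τ (star (k * p) * (k * p)) = T.τ (p * (star k * k)) := by
    have hY : p * (star k * k) ∈ M := mul_mem hp.1 (mul_mem (star_mem hk) hk)
    calc T.τ (star (k * p) * (k * p)) = T.τ ((p * (star k * k)) * p) := by
          rw [star_mul, hp.2.2.star_eq]; simp only [mul_assoc]
      _ = T.τ (p * (p * (star k * k))) := T.tracial _ _ hY hp.1
      _ = T.τ (p * (star k * k)) := by rw [← mul_assoc, hp.2.1.eq]
  rw [he] at h
  exact (Complex.le_def.1 h).1

lemma TracialState.reTr_proj_nonneg (T : TracialState M) {p q : H →L[ℂ] H}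
    (hp : IsProjection M p) (hq : IsProjection M q) : 0 ≤ T.reTr p q := by
  have := T.reTr_star_mul_self_nonneg hp hq.1
  rwa [hq.2.2.star_eq, hq.2.1.eq] at this

lemma TracialState.reTr_comm (T : TracialState M) {p q : H →L[ℂ] H}
    (hp : p ∈ M) (hq : q ∈ M) : T.reTr p q = T.reTr q p := by
  rw [T.reTr_apply, T.reTr_apply, T.tracial _ _ hp hq]

lemma IsProjection.one_sub {p : H →L[ℂ] H} (hp : IsProjection M p) :
    IsProjection M (1 - p) :=
  ⟨sub_mem (one_mem M) hp.1, hp.2.1.one_sub, (IsSelfAdjoint.one _).sub hp.2.2⟩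

lemma IsProj.mul_eq_of_rng_le {p q : H →L[ℂ] H} (hp : IsProj p) (h : rng q ≤ rng p) :
    p * q = q := by
  ext v
  obtain ⟨w, hw⟩ := h ⟨v, rfl⟩
  change p w = q v at hw
  rw [mul_apply_eq_comp, ← hw, ← mul_apply_eq_comp, hp.1.eq]

lemma IsProjection.sub_of_rng_le {p q : H →L[ℂ] H} (hp : IsProjection M p)
    (hq : IsProjection M q) (h : rng q ≤ rng p) : IsProjection M (p - q) := by
  have h1 : p * q = q := hp.2.mul_eq_of_rng_le h
  have h2 : q * p = q := by
    have := congrArg star h1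
    rwa [star_mul, hp.2.2.star_eq, hq.2.2.star_eq] at this
  refine ⟨sub_mem hp.1 hq.1, ?_, hp.2.2.sub hq.2.2⟩
  rw [IsIdempotentElem, sub_mul, mul_sub, mul_sub, hp.2.1.eq, hq.2.1.eq, h1, h2]
  abel

lemma TracialState.reTr_mono_left (T : TracialState M) {p q E : H →L[ℂ] H}
    (hp : IsProjection M p) (hq : IsProjection M q) (hE : IsProjection M E)
    (h : rng q ≤ rng p) : T.reTr q E ≤ T.reTr p E := by
  have := T.reTr_proj_nonneg hE (hp.sub_of_rng_le hq h)
  rw [_root_.map_sub, T.reTr_comm hE.1 hp.1, T.reTr_comm hE.1 hq.1] at this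
  linarith

lemma TracialState.reTr_le_left (T : TracialState M) {p E : H →L[ℂ] H}
    (hp : IsProjection M p) (hE : IsProjection M E) : T.reTr p E ≤ (T.τ E).re := by
  have := T.reTr_proj_nonneg hE hp.one_sub
  rw [_root_.map_sub, T.reTr_one, T.reTr_comm hE.1 hp.1] at this
  linarith

lemma TracialState.reTr_cfc_le (T : TracialState M) {p X : H →L[ℂ] H}
    (hp : IsProjection M p) (hXM : X ∈ M) (hX : IsSelfAdjoint X) {g : ℝ → ℝ} (hg : Continuous g)
    {h C x : ℝ} (h0 : ∀ s, 0 ≤ g s) (hgh : ∀ s, g s ≤ h)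
    (hC : ∀ s, g s ≤ C * (1 - ramp x s)) :
    T.reTr p (cfc g X) ≤ h * T.reTr p (1 - specProj X x) := by
  set E := specProj X x with hE
  set G := cfc g X with hG
  have hEp : IsProjection M E := isProjection_specProj M hXM x
  have hGs : IsSelfAdjoint G := cfc_predicate g X
  have hGE : G * E = 0 := cfc_mul_specProj hX hg C fun s => by
    have := ramp_le_one x s
    rw [abs_of_nonneg (h0 s), abs_of_nonneg (by linarith)]
    exact hC s
  have hEG : E * G = 0 := by
    have := congrArg star hGE
    rwa [star_mul, hEp.2.2.star_eq, hGs.star_eq, star_zero] at this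
  set k := cfc (fun s => √(h - g s)) X with hk
  have hks : IsSelfAdjoint k := cfc_predicate _ X
  have hkM : k ∈ M := cfc_mem_vonNeumannAlgebra M hXM _
  have hkk : k * k = h • (1 : H →L[ℂ] H) - G := by
    rw [hk, ← cfc_mul (fun s => √(h - g s)) (fun s => √(h - g s)) X, hG,
      ← cfc_const_one ℝ X, ← cfc_smul h (fun _ => (1 : ℝ)) X,
      ← cfc_sub (fun _ => h • (1 : ℝ)) g X]
    congr 1
    ext s
    rw [Real.mul_self_sqrt (by linarith [hgh s])]
    simp
  have := T.reTr_star_mul_self_nonneg hp (mul_mem hkM hEp.one_sub.1)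
  have he : star (k * (1 - E)) * (k * (1 - E)) = h • (1 - E) - G := by
    rw [star_mul, hks.star_eq, hEp.one_sub.2.2.star_eq]
    calc (1 - E) * k * (k * (1 - E)) = (1 - E) * (k * k) * (1 - E) := by
          simp only [mul_assoc]
      _ = h • ((1 - E) * (1 - E)) - (1 - E) * (G * (1 - E)) := by
          rw [hkk, mul_sub (1 - E), sub_mul _ ((1 - E) * G), mul_smul_comm, mul_one, smul_mul_assoc,
            mul_assoc]
      _ = h • (1 - E) - G := by
          rw [hEp.2.1.one_sub.eq, mul_sub G, hGE, sub_mul, mul_one, one_mul, sub_zero, hEG,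
            sub_zero]
  rw [he, _root_.map_sub, _root_.map_smul, smul_eq_mul] at this
  linarith

lemma TracialState.reTr_le_integral (T : TracialState M) {p X : H →L[ℂ] H}
    (hp : IsProjection M p) (hXM : X ∈ M) (hX : IsSelfAdjoint X) {R : ℝ} (hR : ‖X‖ ≤ R)
    {Φ : ℝ → ℝ} (hΦ : Antitone Φ) (hle : ∀ x, T.reTr p (1 - specProj X x) ≤ Φ x) :
    T.reTr p X ≤ -R * (T.τ p).re + ∫ x in -R..R, Φ x := by
  have hR0 : 0 ≤ R := (norm_nonneg X).trans hR
  have : Nontrivial H := T.nontrivial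
  have hspec : ∀ s ∈ spectrum ℝ X, -R ≤ s ∧ s ≤ R := fun s hs =>
    abs_le.1 ((spectrum.norm_le_norm_of_mem hs).trans hR)
  set G : ℝ → ℝ := fun x => T.reTr p (cfc (fun s => max 0 (s - x)) X) with hG
  have hstep : ∀ x y, x ≤ y → G x - G y ≤ (y - x) * Φ x := by
    intro x y hxy
    have h1 : G x - G y = T.reTr p (cfc (fun s => max 0 (s - x) - max 0 (s - y)) X) := by
      rw [cfc_sub (fun s => max 0 (s - x)) (fun s => max 0 (s - y)) X, _root_.map_sub]
    rw [h1]
    refine (T.reTr_cfc_le (x := x) (h := y - x) (C := (y - x) + 1) hp hXM hX (by fun_prop)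
      (fun s => ?_) (fun s => ?_) (fun s => ?_)).trans
      (mul_le_mul_of_nonneg_left (hle x) (by linarith))
    · rw [sub_nonneg]; gcongr
    · rcases le_total (s - y) 0 with h | h
      · rw [max_eq_left h]; exact sub_le_iff_le_add.2 (max_le (by linarith) (by linarith))
      · rw [max_eq_right h, max_eq_right (by linarith)]; linarith
    · rw [one_sub_ramp]
      rcases le_total (s - x) 0 with h | h
      · rw [max_eq_left h, max_eq_left (by linarith)]; simp
      · rw [max_eq_right h]
        rcases le_total (s - x) 1 with h' | h'
        · rw [min_eq_right h']; nlinarith [le_max_left 0 (s - y)]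
        · rw [min_eq_left h']
          rcases le_total (s - y) 0 with h2 | h2
          · rw [max_eq_left h2]; linarith
          · rw [max_eq_right h2]; linarith
  have hGR : G R = 0 := by
    have : cfc (fun s => max 0 (s - R)) X = cfc (fun _ => (0 : ℝ)) X :=
      cfc_congr fun s hs => max_eq_left (by linarith [(hspec s hs).2])
    rw [hG]; simp only []
    rw [this, cfc_const_zero, _root_.map_zero]
  have hGm : G (-R) = T.reTr p X + R * (T.τ p).re := by
    have : cfc (fun s => max 0 (s - -R)) X = X + R • 1 := by
      rw [cfc_congr (g := fun s => s + R) fun s hs => by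
          have := (hspec s hs).1
          simp only []
          rw [max_eq_right (by linarith)]; ring]
      rw [cfc_add X (fun s => s) (fun _ => R), cfc_id' ℝ X, cfc_const R X,
        Algebra.algebraMap_eq_smul_one]
    rw [hG]; simp only []
    rw [this, _root_.map_add, _root_.map_smul, T.reTr_one, smul_eq_mul]
  suffices h : G (-R) ≤ ∫ x in -R..R, Φ x by linarith
  have hN : ∀ N : ℕ, G (-R) ≤ (∫ x in -R..R, Φ x) +
      2 * R * (Φ (-R) - Φ R) * (1 / ((N : ℝ) + 1)) := by
    intro N
    set d : ℝ := 2 * R / ((N : ℝ) + 1) with hd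
    have hd0 : 0 ≤ d := by positivity
    have hdN : d * ((N : ℝ) + 1) = 2 * R := by rw [hd]; field_simp
    set Ψ : ℝ → ℝ := fun u => Φ (-R + d * u) with hΨ
    have hΨa : Antitone Ψ := fun u v huv => hΦ (by gcongr)
    have h1 := AntitoneOn.sum_le_integral (x₀ := 0) (a := N + 1) (f := Ψ) (hΨa.antitoneOn _)
    have h2 : G (-R) - G R ≤ ∑ i ∈ Finset.range (N + 1), d * Ψ i := by
      have ht := Finset.sum_range_sub' (fun i : ℕ => G (-R + d * i)) (N + 1)
      have e0 : -R + d * ((0 : ℕ) : ℝ) = -R := by simp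
      have e1 : -R + d * ((N + 1 : ℕ) : ℝ) = R := by push_cast; rw [hdN]; ring
      rw [e0, e1] at ht
      rw [← ht]
      refine Finset.sum_le_sum fun i _ => ?_
      refine (hstep _ _ (by push_cast; nlinarith)).trans_eq ?_
      rw [hΨ]; push_cast; ring
    have h3 : d * ∫ u in (0 : ℝ)..(0 + (N + 1 : ℕ)), Ψ u = ∫ x in -R..R, Φ x := by
      have := intervalIntegral.mul_integral_comp_add_mul (a := 0) (b := (N : ℝ) + 1) (f := Φ) (c := d) (d := -R)
      rw [zero_add]; push_cast
      rw [hΨ, this, hdN]; congr 1 <;> ring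
    have h4 : ∑ i ∈ Finset.range (N + 1), Ψ i =
        ∑ i ∈ Finset.range (N + 1), Ψ (0 + (i + 1 : ℕ)) + (Φ (-R) - Φ R) := by
      have := Finset.sum_range_sub' (fun i : ℕ => Ψ i) (N + 1)
      rw [Finset.sum_sub_distrib] at this
      have e0 : Ψ ((0 : ℕ) : ℝ) = Φ (-R) := by simp [hΨ]
      have e1 : Ψ ((N + 1 : ℕ) : ℝ) = Φ R := by
        simp only [hΨ]; push_cast; rw [hdN]; congr 1; ring
      rw [e0, e1] at this
      simp only [zero_add]
      linarith
    rw [← Finset.mul_sum, h4, hGR, sub_zero, mul_add] at h2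
    have h5 := mul_le_mul_of_nonneg_left h1 hd0
    rw [h3] at h5
    calc G (-R) ≤ _ := h2
      _ ≤ (∫ x in -R..R, Φ x) + d * (Φ (-R) - Φ R) := by gcongr
      _ = _ := by rw [hd]; ring
  have := (tendsto_one_div_add_atTop_nhds_zero_nat (𝕜 := ℝ)).const_mul (2 * R * (Φ (-R) - Φ R))
  refine ge_of_tendsto (x := atTop) ?_ (Eventually.of_forall hN)
  simpa only [mul_zero, add_zero] using this.const_add (∫ x in -R..R, Φ x)

lemma TracialState.norm_vector {T : TracialState M} {Ω : H}
    (hΩ : ∀ y, T.τ y = inner ℂ Ω (y Ω)) : ‖Ω‖ = 1 := by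
  have h := hΩ 1
  rw [T.normalized, one_apply_eq_self, inner_self_eq_norm_sq_to_K] at h
  have h2 : ‖Ω‖ ^ 2 = 1 := by
    apply Complex.ofReal_injective
    push_cast
    exact h.symm
  nlinarith [norm_nonneg Ω, sq_nonneg (‖Ω‖ - 1)]

lemma TracialState.norm_le_of_vector {T : TracialState M} {Ω : H}
    (hΩ : ∀ y, T.τ y = inner ℂ Ω (y Ω)) (y : H →L[ℂ] H) : ‖T.τ y‖ ≤ ‖y‖ := by
  rw [hΩ]
  refine (norm_inner_le_norm _ _).trans ?_
  rw [T.norm_vector hΩ, one_mul]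
  simpa [T.norm_vector hΩ] using y.le_opNorm Ω

lemma TracialState.trace_aeval (T : TracialState M) {X : H →L[ℂ] H} {ν : Measure ℝ}
    [IsProbabilityMeasure ν] {R : ℝ} (hs : ν (Set.Icc (-R) R)ᶜ = 0)
    (hm : ∀ k, T.τ (X ^ k) = ((∫ x, x ^ k ∂ν : ℝ) : ℂ)) (q : Polynomial ℝ) :
    T.τ (Polynomial.aeval X q) = ((∫ x, q.eval x ∂ν : ℝ) : ℂ) ∧
      Integrable (fun x => q.eval x) ν := by
  induction q using Polynomial.induction_on' with
  | add p q hp hq =>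
    simp only [_root_.map_add, Polynomial.eval_add]
    exact ⟨by rw [T.map_add, hp.1, hq.1, integral_add hp.2 hq.2]; push_cast; rfl,
      hp.2.add hq.2⟩
  | monomial k c =>
    simp only [Polynomial.aeval_monomial, Polynomial.eval_monomial]
    refine ⟨?_, (integrable_pow_of_support hs k).const_mul c⟩
    rw [Algebra.algebraMap_eq_smul_one, smul_mul_assoc, one_mul, ← Complex.coe_smul,
      T.map_smul, hm, integral_const_mul]
    push_cast; rfl

lemma TracialState.trace_cfc (T : TracialState M) {Ω : H}
    (hΩ : ∀ y, T.τ y = inner ℂ Ω (y Ω)) {X : H →L[ℂ] H} (hX : IsSelfAdjoint X)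
    {ν : Measure ℝ} [IsProbabilityMeasure ν] {R : ℝ} (hs : ν (Set.Icc (-R) R)ᶜ = 0)
    (hm : ∀ k, T.τ (X ^ k) = ((∫ x, x ^ k ∂ν : ℝ) : ℂ)) (hR : ‖X‖ ≤ R) {f : ℝ → ℝ}
    (hf : Continuous f) : T.τ (cfc f X) = ((∫ x, f x ∂ν : ℝ) : ℂ) := by
  have : Nontrivial H := T.nontrivial
  have hae : ∀ᵐ x ∂ν, x ∈ Set.Icc (-R) R := hs
  have hfi : Integrable f ν := by
    obtain ⟨C, hC⟩ := isCompact_Icc.exists_bound_of_continuousOn (s := Set.Icc (-R) R)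
      hf.continuousOn
    exact Integrable.of_bound hf.aestronglyMeasurable C (hae.mono hC)
  rw [← sub_eq_zero, ← norm_eq_zero]
  refine le_antisymm (le_of_forall_pos_le_add fun ε hε => ?_) (norm_nonneg _)
  obtain ⟨q, hq⟩ := exists_polynomial_near_of_continuousOn (-R) R f hf.continuousOn (ε / 2)
    (by positivity)
  obtain ⟨h1, h2⟩ := T.trace_aeval hs hm q
  have h3 : ‖T.τ (cfc f X) - T.τ (Polynomial.aeval X q)‖ ≤ ε / 2 := by
    have he : T.τ (cfc f X) - T.τ (Polynomial.aeval X q) =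
        T.τ (cfc (fun x => f x - q.eval x) X) := by
      rw [cfc_sub f q.eval X, cfc_polynomial q X, hΩ, hΩ, hΩ, sub_apply, inner_sub_right]
    rw [he]
    refine (T.norm_le_of_vector hΩ _).trans (norm_cfc_le (by positivity) fun x hx => ?_)
    have hx' := abs_le.1 ((spectrum.norm_le_norm_of_mem hx).trans hR)
    rw [norm_sub_rev]
    exact (hq x ⟨hx'.1, hx'.2⟩).le
  have h4 : ‖∫ x, q.eval x ∂ν - ∫ x, f x ∂ν‖ ≤ ε / 2 := by
    rw [← integral_sub h2 hfi]
    refine (norm_integral_le_of_norm_le_const (C := ε / 2)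
      (hae.mono fun x hx => (hq x hx).le)).trans ?_
    simp
  calc ‖T.τ (cfc f X) - ((∫ x, f x ∂ν : ℝ) : ℂ)‖
      = ‖(T.τ (cfc f X) - T.τ (Polynomial.aeval X q)) +
          ((∫ x, q.eval x ∂ν - ∫ x, f x ∂ν : ℝ) : ℂ)‖ := by
        rw [h1]; congr 1; push_cast; ring
    _ ≤ ε / 2 + ε / 2 := (norm_add_le _ _).trans (add_le_add h3 (by
        rw [Complex.norm_real]; exact h4))
    _ = 0 + ε := by ring

lemma TracialState.trace_specProj (T : TracialState M) {Ω : H}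
    (hΩ : ∀ y, T.τ y = inner ℂ Ω (y Ω)) {X : H →L[ℂ] H} (hXM : X ∈ M) (hX : IsSelfAdjoint X)
    {ν : Measure ℝ} [IsProbabilityMeasure ν] {R : ℝ} (hs : ν (Set.Icc (-R) R)ᶜ = 0)
    (hm : ∀ k, T.τ (X ^ k) = ((∫ x, x ^ k ∂ν : ℝ) : ℂ)) (hR : ‖X‖ ≤ R) (x : ℝ) :
    T.τ (specProj X x) = ((ν.real (Set.Iic x) : ℝ) : ℂ) := by
  have hE := isProjection_specProj M hXM x
  have h0 := T.pos _ hE.1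
  rw [hE.2.2.star_eq, hE.2.1.eq] at h0
  refine Complex.ext ?_ (by rw [← (Complex.le_def.1 h0).2]; simp)
  rw [Complex.ofReal_re, hΩ]
  refine re_inner_specProj ?_
  have hc := continuous_ramp x
  have h1 : ∀ k : ℕ, (inner ℂ Ω ((cfc (ramp x) X ^ k) Ω)).re = ∫ s, ramp x s ^ k ∂ν := by
    intro k
    rw [← cfc_pow (ramp x) k X, ← hΩ, T.trace_cfc hΩ hX hs hm hR (by fun_prop),
      Complex.ofReal_re]
  simp only [h1]
  have h2 : ν.real (Set.Iic x) = ∫ s, (Set.Iic x).indicator (fun _ => (1 : ℝ)) s ∂ν := by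
    rw [integral_indicator_const _ measurableSet_Iic]; simp
  rw [h2]
  refine tendsto_integral_of_dominated_convergence (fun _ => 1)
    (fun k => (hc.pow k).aestronglyMeasurable) (integrable_const 1) (fun k => ?_) ?_
  · refine Eventually.of_forall fun s => ?_
    rw [Real.norm_eq_abs, abs_of_nonneg (pow_nonneg (ramp_nonneg x s) k)]
    exact pow_le_one₀ (ramp_nonneg x s) (ramp_le_one x s)
  · refine Eventually.of_forall fun s => ?_
    have h3 := one_sub_ramp x s
    by_cases hsx : s ≤ x
    · have : ramp x s = 1 := by
        rw [max_eq_left (by linarith), min_eq_right zero_le_one] at h3; linarith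
      simp [Set.indicator_of_mem (Set.mem_Iic.2 hsx), this]
    · have hlt : ramp x s < 1 := by
        push Not at hsx
        have : 0 < 1 - ramp x s := by
          rw [h3]; exact lt_min one_pos (lt_max_of_lt_right (by linarith))
        linarith
      rw [Set.indicator_of_notMem (by simpa using hsx)]
      exact tendsto_pow_atTop_nhds_zero_of_lt_one (ramp_nonneg x s) hlt

lemma elem_eq_orderEmbOfFin {I : Finset ℕ} {r : ℕ} (hI : I.card = r) (j : Fin r) :
    elem I (j + 1) = I.orderEmbOfFin hI j := by
  rw [Finset.orderEmbOfFin_apply, elem, if_neg (Nat.succ_ne_zero _), Nat.add_sub_cancel,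
    List.getD_eq_getElem]
  rfl

lemma elem_mem {I : Finset ℕ} {l : ℕ} (hl : 1 ≤ l) (hlr : l ≤ I.card) : elem I l ∈ I := by
  have := elem_eq_orderEmbOfFin rfl (⟨l - 1, by omega⟩ : Fin I.card)
  simp only [Nat.sub_add_cancel hl] at this
  rw [this]
  exact Finset.orderEmbOfFin_mem _ _ _

lemma elem_card_filter_le {I : Finset ℕ} {m : ℕ} (hm : m ∈ I) :
    elem I (I.filter (· ≤ m)).card = m := by
  have h1 : m ∈ Set.range (I.orderEmbOfFin rfl) := by
    rw [Finset.range_orderEmbOfFin]; exact hm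
  obtain ⟨j, hj⟩ := h1
  have h2 : I.filter (· ≤ m) = (Finset.Iic j).map (I.orderEmbOfFin rfl).toEmbedding := by
    ext i
    simp only [Finset.mem_filter, Finset.mem_map, Finset.mem_Iic]
    constructor
    · rintro ⟨hi, him⟩
      have h3 : i ∈ Set.range (I.orderEmbOfFin rfl) := by
        rw [Finset.range_orderEmbOfFin]; exact hi
      obtain ⟨k, hk⟩ := h3
      refine ⟨k, ?_, hk⟩
      rw [← (I.orderEmbOfFin rfl).le_iff_le, hk, hj]; exact him
    · rintro ⟨k, hk, rfl⟩
      exact ⟨Finset.orderEmbOfFin_mem _ _ _, hj ▸ (I.orderEmbOfFin rfl).le_iff_le.2 hk⟩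
  rw [h2, Finset.card_map, Fin.card_Iic, elem_eq_orderEmbOfFin rfl, hj]

/-- The length of `ω_I ∩ [0, t]`. -/
noncomputable def omegaLength (n : ℕ) (I : Finset ℕ) (t : ℝ) : ℝ :=
  ∑ i ∈ I, max 0 (min (1 / n) (t - ((i : ℝ) - 1) / n))

lemma monotone_omegaLength (n : ℕ) (I : Finset ℕ) : Monotone (omegaLength n I) := by
  intro s t hst
  unfold omegaLength
  gcongr

lemma omegaLength_nonneg (n : ℕ) (I : Finset ℕ) (t : ℝ) : 0 ≤ omegaLength n I t :=
  Finset.sum_nonneg fun _ _ => le_max_left _ _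

lemma omegaLength_le (n : ℕ) (I : Finset ℕ) (t : ℝ) : omegaLength n I t ≤ (I.card : ℝ) / n := by
  refine (Finset.sum_le_card_nsmul _ _ (1 / (n : ℝ)) fun i _ =>
    max_le (by positivity) (min_le_left _ _)).trans_eq ?_
  rw [nsmul_eq_mul, mul_one_div]

lemma omegaLength_le_of_elem {n : ℕ} {I : Finset ℕ} {t B : ℝ} (hB : 0 ≤ B)
    (h : ∀ l, 1 ≤ l → l ≤ I.card → (l : ℝ) / n - max 0 ((elem I l : ℝ) / n - t) ≤ B) :
    omegaLength n I t ≤ B := by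
  classical
  set S := I.filter (fun i : ℕ => ((i : ℝ) - 1) / n < t) with hS
  have hsum : omegaLength n I t = ∑ i ∈ S, max 0 (min (1 / (n : ℝ)) (t - ((i : ℝ) - 1) / n)) := by
    rw [omegaLength, hS, Finset.sum_filter_of_ne]
    intro i _ hi
    by_contra hlt
    exact hi (max_eq_left ((min_le_right _ _).trans (by linarith)))
  rcases S.eq_empty_or_nonempty with he | hne
  · rw [hsum, he, Finset.sum_empty]; exact hB
  set m := S.max' hne with hm
  have hmS : m ∈ S := S.max'_mem hne
  have hmI : m ∈ I := (Finset.mem_filter.1 hmS).1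
  have hmt : ((m : ℝ) - 1) / n < t := (Finset.mem_filter.1 hmS).2
  have hSm : S = I.filter (· ≤ m) := by
    ext i
    simp only [hS, Finset.mem_filter]
    refine and_congr_right fun hi => ⟨fun hit => S.le_max' i (Finset.mem_filter.2 ⟨hi, hit⟩),
      fun him => lt_of_le_of_lt ?_ hmt⟩
    gcongr
  have helem : elem I S.card = m := by rw [hSm]; exact elem_card_filter_le hmI
  have hcard : 1 ≤ S.card := hne.card_pos
  have hl := h S.card hcard (Finset.card_filter_le _ _)
  rw [helem] at hl
  refine le_trans ?_ hl
  rw [hsum, ← Finset.add_sum_erase S _ hmS]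
  have h1 : ∑ i ∈ S.erase m, max 0 (min (1 / (n : ℝ)) (t - ((i : ℝ) - 1) / n)) ≤
      ((S.card : ℝ) - 1) * (1 / n) := by
    refine (Finset.sum_le_card_nsmul _ _ (1 / (n : ℝ)) fun i _ =>
      max_le (by positivity) (min_le_left _ _)).trans_eq ?_
    rw [nsmul_eq_mul, Finset.card_erase_of_mem hmS, Nat.cast_sub hcard, Nat.cast_one]
  have h2 : max 0 (min (1 / (n : ℝ)) (t - ((m : ℝ) - 1) / n)) =
      1 / n - max 0 ((m : ℝ) / n - t) := by
    rw [max_eq_right (le_min (by positivity) (by linarith)), sub_div]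
    rcases le_total 0 ((m : ℝ) / n - t) with h0 | h0
    · rw [max_eq_right h0, min_eq_right (by linarith)]; ring
    · rw [max_eq_left h0, min_eq_left (by linarith)]; ring
  rw [h2]
  calc _ ≤ 1 / (n : ℝ) - max 0 ((m : ℝ) / n - t) + ((S.card : ℝ) - 1) * (1 / n) := by gcongr
    _ = _ := by ring

lemma TracialState.le_reTr_specProj (T : TracialState M) {p q X : H →L[ℂ] H}
    (hXM : X ∈ M) (hX : IsSelfAdjoint X) (hp : IsProjection M p) {x y : ℝ}
    (hqM : q ∈ M) (hq : IsMeetOf q (specProj X y) p) :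
    (T.τ q).re - max 0 ((T.τ (specProj X y)).re - (T.τ (specProj X x)).re) ≤
      T.reTr p (specProj X x) := by
  have hqp : IsProjection M q := ⟨hqM, hq.1⟩
  have hEx := isProjection_specProj M hXM x
  have hEy := isProjection_specProj M hXM y
  have hle : rng q ≤ rng (specProj X y) := hq.2.le.trans inf_le_left
  refine le_trans ?_ (T.reTr_mono_left hp hqp hEx (hq.2.le.trans inf_le_right))
  have hself : ∀ E, IsProj E → rng q ≤ rng E → E ∈ M → T.reTr q E = (T.τ q).re := by
    intro E hE h hEM
    rw [T.reTr_comm hqM hEM, T.reTr_apply, hE.mul_eq_of_rng_le h]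
  rcases le_total y x with hyx | hxy
  · rw [hself _ hEx.2 (hle.trans (rng_specProj_mono hX hyx)) hEx.1]
    linarith [le_max_left 0 ((T.τ (specProj X y)).re - (T.τ (specProj X x)).re)]
  · have h1 := T.reTr_le_left hqp (hEy.sub_of_rng_le hEx (rng_specProj_mono hX hxy))
    rw [_root_.map_sub, hself _ hEy.2 hle hEy.1, T.map_sub, Complex.sub_re] at h1
    linarith [le_max_right 0 ((T.τ (specProj X y)).re - (T.τ (specProj X x)).re)]

lemma smear_singleton {μ : Measure ℝ} [IsProbabilityMeasure μ] {δ : ℝ} (hδ : 0 < δ) (x : ℝ) :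
    smear μ δ {x} = 0 := by
  have hm := measurable_smear_aux δ
  rw [smear, Measure.map_apply hm (measurableSet_singleton x),
    Measure.measure_prod_null (hm (measurableSet_singleton x))]
  refine Eventually.of_forall fun y => Set.Subsingleton.measure_zero ?_ _
  intro s hs t ht
  have h : y + δ * (s : ℝ) = y + δ * (t : ℝ) := Eq.trans hs (Eq.symm ht)
  exact Subtype.ext (mul_left_cancel₀ hδ.ne' (add_left_cancel h))

lemma le_smear_Iic {μ : Measure ℝ} [IsProbabilityMeasure μ] {δ : ℝ} (hδ : 0 ≤ δ) (x : ℝ) :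
    μ.real (Set.Iic (x - δ)) ≤ (smear μ δ).real (Set.Iic x) := by
  have h1 : μ (Set.Iic (x - δ)) = (μ.prod (volume : Measure unitInterval))
      (Set.Iic (x - δ) ×ˢ Set.univ) := by simp [Measure.prod_prod]
  rw [measureReal_def, measureReal_def, h1, smear,
    Measure.map_apply (measurable_smear_aux δ) measurableSet_Iic]
  refine ENNReal.toReal_mono (measure_ne_top _ _) (measure_mono ?_)
  rintro ⟨y, t⟩ ⟨hy, -⟩
  have := mul_le_mul_of_nonneg_left t.2.2 hδ
  simp only [Set.mem_Iic, Set.mem_preimage] at hy ⊢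
  linarith

lemma continuous_measureReal_Iic {ν : Measure ℝ} [IsProbabilityMeasure ν]
    (hν : ∀ x, ν {x} = 0) : Continuous fun x => ν.real (Set.Iic x) := by
  rw [continuous_iff_continuousAt]
  intro x
  have h : (fun x => ν.real (Set.Iic x)) =
      fun x => ∫ s, (Set.Iic x).indicator (fun _ => (1 : ℝ)) s ∂ν := by
    ext y; rw [integral_indicator_const _ measurableSet_Iic]; simp
  rw [h]
  refine continuousAt_of_dominated (bound := fun _ => 1) ?_ ?_ (integrable_const 1) ?_
  · exact Eventually.of_forall fun y =>
      ((measurable_const.indicator measurableSet_Iic).aestronglyMeasurable)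
  · refine Eventually.of_forall fun y => Eventually.of_forall fun s => ?_
    refine (norm_indicator_le_norm_self _ _).trans (by simp)
  · have : ∀ᵐ s ∂ν, s ≠ x := hν x |> fun h => compl_mem_ae_iff.2 h
    filter_upwards [this] with s hs
    rcases lt_or_gt_of_ne hs with h | h
    · refine continuousAt_const.congr (f := fun _ => (1 : ℝ)) ?_
      filter_upwards [lt_mem_nhds h] with y hy
      rw [Set.indicator_of_mem (Set.mem_Iic.2 hy.le)]
    · refine continuousAt_const.congr (f := fun _ => (0 : ℝ)) ?_
      filter_upwards [gt_mem_nhds h] with y hy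
      rw [Set.indicator_of_notMem (by simpa using hy)]

lemma monotone_measureReal_Iic (ν : Measure ℝ) [IsFiniteMeasure ν] :
    Monotone fun x => ν.real (Set.Iic x) :=
  fun _ _ h => measureReal_mono (Set.Iic_subset_Iic.2 h)

lemma exists_measureReal_Iic_eq {ν : Measure ℝ} [IsProbabilityMeasure ν]
    (hν : ∀ x, ν {x} = 0) {R : ℝ} (hs : ν (Set.Icc (-R) R)ᶜ = 0) {t : ℝ}
    (ht : t ∈ Set.Icc (0 : ℝ) 1) : ∃ x, ν.real (Set.Iic x) = t := by
  have h0 : ν.real (Set.Iic (-R - 1)) = 0 := by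
    rw [measureReal_def, measure_mono_null _ hs, ENNReal.toReal_zero]
    intro s hs' hs''
    have := hs''.1
    simp only [Set.mem_Iic] at hs'
    linarith
  have h1 : ν.real (Set.Iic R) = 1 := by
    rw [measureReal_def, (prob_compl_eq_zero_iff measurableSet_Iic).1, ENNReal.toReal_one]
    exact measure_mono_null (Set.compl_subset_compl.2 fun s h => h.2) hs
  rcases le_total (-R - 1) R with h | h
  · obtain ⟨x, -, hx⟩ := intermediate_value_Icc h (continuous_measureReal_Iic hν).continuousOn
      (by simpa only [h0, h1] using ht)
    exact ⟨x, hx⟩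
  · have := monotone_measureReal_Iic ν h
    simp only [h0, h1] at this
    linarith

/-- A self-adjoint element with an atomless spectral distribution has a flag of spectral
projections, and any projection meeting this flag generically enough satisfies a trace bound. -/
theorem TracialState.exists_flag (T : TracialState M) {Ω : H}
    (hΩ : ∀ y, T.τ y = inner ℂ Ω (y Ω)) {X : H →L[ℂ] H} (hXM : X ∈ M) (hX : IsSelfAdjoint X)
    {ν : Measure ℝ} [IsProbabilityMeasure ν] (hν : ∀ x, ν {x} = 0) {R : ℝ}
    (hs : ν (Set.Icc (-R) R)ᶜ = 0)
    (hm : ∀ k, T.τ (X ^ k) = ((∫ x, x ^ k ∂ν : ℝ) : ℂ)) (hR : ‖X‖ ≤ R) :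
    ∃ e, IsFlag M T e ∧ ∀ (n : ℕ) (I : Finset ℕ) (p : H →L[ℂ] H), I ⊆ Finset.Icc 1 n →
      IsProjection M p →
      (∀ l, 1 ≤ l → l ≤ I.card → ∃ q, q ∈ M ∧ IsMeetOf q (e ((elem I l : ℝ) / n)) p ∧
        (((l : ℝ) / n : ℝ) : ℂ) ≤ T.τ q) →
      T.reTr p X ≤ R * (T.τ p).re - ∫ x in -R..R, omegaLength n I (ν.real (Set.Iic x)) := by
  have htr := T.trace_specProj hΩ hXM hX hs hm hR
  have hex : ∀ t : ℝ, ∃ x, t ∈ Set.Icc (0 : ℝ) 1 → ν.real (Set.Iic x) = t := by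
    intro t
    by_cases ht : t ∈ Set.Icc (0 : ℝ) 1
    · obtain ⟨x, hx⟩ := exists_measureReal_Iic_eq hν hs ht
      exact ⟨x, fun _ => hx⟩
    · exact ⟨0, fun h => absurd h ht⟩
  choose L hL using hex
  refine ⟨fun t => specProj X (L t), ⟨fun t _ => isProjection_specProj M hXM _, ?_, ?_⟩, ?_⟩
  · intro s hs' t ht hst
    rcases eq_or_lt_of_le hst with rfl | hlt
    · exact le_rfl
    · refine rng_specProj_mono hX (le_of_not_gt fun hgt => ?_)
      have := monotone_measureReal_Iic ν hgt.le
      simp only [hL s hs', hL t ht] at this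
      linarith
  · intro t ht
    rw [htr, hL t ht]
  · intro n I p hI hp hq
    have hmono : Monotone fun x => omegaLength n I (ν.real (Set.Iic x)) :=
      (monotone_omegaLength n I).comp (monotone_measureReal_Iic ν)
    have hle : ∀ x, T.reTr p (1 - specProj X x) ≤
        (T.τ p).re - omegaLength n I (ν.real (Set.Iic x)) := by
      intro x
      rw [_root_.map_sub, T.reTr_one]
      refine sub_le_sub_left (omegaLength_le_of_elem
        (T.reTr_proj_nonneg hp (isProjection_specProj M hXM x)) fun l hl hlr => ?_) _
      obtain ⟨q, hqM, hqm, hql⟩ := hq l hl hlr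
      have hmem := Finset.mem_Icc.1 (hI (elem_mem hl hlr))
      have ht : ((elem I l : ℝ) / n) ∈ Set.Icc (0 : ℝ) 1 :=
        ⟨by positivity, div_le_one_of_le₀ (by exact_mod_cast hmem.2) (by positivity)⟩
      have h1 := T.le_reTr_specProj hXM hX hp (x := x) hqM hqm
      rw [htr, htr, hL _ ht, Complex.ofReal_re, Complex.ofReal_re] at h1
      have h2 := (Complex.le_def.1 hql).1
      rw [Complex.ofReal_re] at h2
      linarith
    have := T.reTr_le_integral hp hXM hX hR (fun x y h => sub_le_sub_left (hmono h) _) hle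
    rw [intervalIntegral.integral_sub (by simp) hmono.intervalIntegrable,
      intervalIntegral.integral_const, smul_eq_mul] at this
    linarith

lemma integral_comp_sub_ge {g : ℝ → ℝ} (hg : Monotone g) (h0 : ∀ x, 0 ≤ g x) {c : ℝ}
    (hc : ∀ x, g x ≤ c) {δ : ℝ} (hδ : 0 ≤ δ) (R : ℝ) :
    (∫ x in -R..R, g x) - δ * c ≤ ∫ x in -R..R, g (x - δ) := by
  rw [intervalIntegral.integral_comp_sub_right]
  have hi : ∀ a b, IntervalIntegrable g volume a b := fun a b => hg.intervalIntegrable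
  have e1 := intervalIntegral.integral_add_adjacent_intervals (hi (-R - δ) (-R)) (hi (-R) (R - δ))
  have e2 := intervalIntegral.integral_add_adjacent_intervals (hi (-R) (R - δ)) (hi (R - δ) R)
  have e3 : 0 ≤ ∫ x in (-R - δ)..(-R), g x :=
    intervalIntegral.integral_nonneg (by linarith) fun x _ => h0 x
  have e4 : ∫ x in (R - δ)..R, g x ≤ ∫ x in (R - δ)..R, c :=
    intervalIntegral.integral_mono_on (by linarith) (hi _ _) (by simp) fun x _ => hc x
  rw [intervalIntegral.integral_const, smul_eq_mul, sub_sub_cancel] at e4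
  linarith

/-- The quantity `R|I|/n - ∫_{-R}^R |ω_I ∩ [0, F_μ(x)]| dx`, with `F_μ` the distribution
function of `μ`. -/
noncomputable def hornBound (n : ℕ) (I : Finset ℕ) (R : ℝ) (μ : Measure ℝ) : ℝ :=
  R * ((I.card : ℝ) / n) - ∫ x in -R..R, omegaLength n I (μ.real (Set.Iic x))

/-- For a self-adjoint `a`, the element `a + δ t` has a flag of spectral projections, and any
projection meeting this flag generically enough satisfies a trace bound. -/
theorem exists_flag_of_shift {A : Type} [CStarAlgebra A] {φ : A →ₗ[ℂ] ℂ} (h1 : φ 1 = 1)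
    {H : Type} [NormedAddCommGroup H] [InnerProductSpace ℂ H] [CompleteSpace H]
    {M : VonNeumannAlgebra H} {T : TracialState M} {π : C(unitInterval, A) →⋆ₐ[ℂ] (H →L[ℂ] H)}
    {Ω : H} (hπM : ∀ x, π x ∈ M) (hπ : ∀ x, T.τ (π x) = ∫ t, φ (x t))
    (hΩ : ∀ y, T.τ y = inner ℂ Ω (y Ω)) {a : A} (ha : IsSelfAdjoint a) {μ : Measure ℝ}
    [IsProbabilityMeasure μ] {R : ℝ} (hs : μ (Set.Icc (-(R - 1)) (R - 1))ᶜ = 0)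
    (hm : ∀ k : ℕ, 1 ≤ k → φ (a ^ k) = ((∫ x, x ^ k ∂μ : ℝ) : ℂ)) (hR : ‖a‖ + 1 ≤ R)
    {δ : ℝ} (hδ : 0 < δ) (hδ1 : δ ≤ 1) :
    ∃ e, IsFlag M T e ∧ ∀ (n : ℕ) (I : Finset ℕ) (p : H →L[ℂ] H), I ⊆ Finset.Icc 1 n →
      IsProjection M p → (T.τ p).re ≤ (I.card : ℝ) / n + δ →
      (∀ l, 1 ≤ l → l ≤ I.card → ∃ q, q ∈ M ∧ IsMeetOf q (e ((elem I l : ℝ) / n)) p ∧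
        (((l : ℝ) / n : ℝ) : ℂ) ≤ T.τ q) →
      T.reTr p (π (ContinuousMap.const unitInterval a + (δ : ℂ) • coordFn A)) ≤
        hornBound n I R μ + δ * (R + (I.card : ℝ) / n) := by
  set x := ContinuousMap.const unitInterval a + (δ : ℂ) • coordFn A with hx
  have hR0 : 0 ≤ R := by linarith [norm_nonneg a]
  have hnx : ‖x‖ ≤ R := by
    have e1 : ‖ContinuousMap.const unitInterval a‖ ≤ ‖a‖ :=
      (ContinuousMap.norm_le _ (norm_nonneg a)).2 fun _ => le_rfl
    have e2 : ‖(δ : ℂ) • coordFn A‖ ≤ 1 := by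
      rw [norm_smul, Complex.norm_real, Real.norm_eq_abs, abs_of_pos hδ]
      exact mul_le_one₀ hδ1 (norm_nonneg _) (norm_coordFn_le A)
    exact (norm_add_le _ _).trans (by linarith)
  have hxs : IsSelfAdjoint x := by
    ext t
    change star (a + (δ : ℂ) • ((t : ℝ) : ℂ) • (1 : A)) = a + (δ : ℂ) • ((t : ℝ) : ℂ) • (1 : A)
    simp [ha.star_eq]
  have hsupp : smear μ δ (Set.Icc (-R) R)ᶜ = 0 := by
    refine measure_mono_null (Set.compl_subset_compl.2 (Set.Icc_subset_Icc ?_ ?_))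
      (smear_support hs hδ.le) <;> linarith
  have hmom : ∀ k, T.τ (π x ^ k) = ((∫ s, s ^ k ∂(smear μ δ) : ℝ) : ℂ) := by
    intro k
    rw [← map_pow, hπ]
    exact integral_pow_shift φ h1 a ⟨_, hs⟩ hm hδ.le k
  obtain ⟨e, he, hb⟩ := T.exists_flag hΩ (hπM x) (hxs.map π) (smear_singleton hδ) hsupp hmom
    ((NonUnitalStarAlgHom.norm_apply_le π x).trans hnx)
  refine ⟨e, he, fun n I p hI hp hpr hq => (hb n I p hI hp hq).trans ?_⟩
  have hmono : Monotone fun x => omegaLength n I (μ.real (Set.Iic x)) :=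
    (monotone_omegaLength n I).comp (monotone_measureReal_Iic μ)
  have hmono' : Monotone fun x => omegaLength n I (μ.real (Set.Iic (x - δ))) :=
    fun x y h => hmono (sub_le_sub_right h δ)
  have hmono'' : Monotone fun x => omegaLength n I ((smear μ δ).real (Set.Iic x)) :=
    (monotone_omegaLength n I).comp (monotone_measureReal_Iic _)
  have e1 := integral_comp_sub_ge hmono (fun _ => omegaLength_nonneg _ _ _)
    (fun _ => omegaLength_le _ _ _) hδ.le R
  have e2 : ∫ x in -R..R, omegaLength n I (μ.real (Set.Iic (x - δ))) ≤
      ∫ x in -R..R, omegaLength n I ((smear μ δ).real (Set.Iic x)) :=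
    intervalIntegral.integral_mono_on (by linarith) hmono'.intervalIntegrable
      hmono''.intervalIntegrable fun x _ => monotone_omegaLength n I (le_smear_Iic hδ.le x)
  have e3 := mul_le_mul_of_nonneg_left hpr hR0
  rw [hornBound]
  linarith

/-- The Horn inequality in terms of distribution functions, for a triple with sum zero. -/
theorem hornBound_nonneg {n r : ℕ} {I J K : Finset ℕ} (hI : I ⊆ Finset.Icc 1 n)
    (hJ : J ⊆ Finset.Icc 1 n) (hK : K ⊆ Finset.Icc 1 n) (hIr : I.card = r) (hJr : J.card = r)
    (hKr : K.card = r) (hP : PropertyAP n r (elem I) (elem J) (elem K))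
    {A : Type} [CStarAlgebra A] (φ : A →ₗ[ℂ] ℂ)
    (hpos : ∀ x, 0 ≤ φ (star x * x)) (htr : ∀ x y, φ (x * y) = φ (y * x)) (h1 : φ 1 = 1)
    {a b c : A} (ha : IsSelfAdjoint a) (hb : IsSelfAdjoint b) (hc : IsSelfAdjoint c)
    (habc : a + b + c = 0) {μa μb μc : Measure ℝ} [IsProbabilityMeasure μa]
    [IsProbabilityMeasure μb] [IsProbabilityMeasure μc] {R : ℝ}
    (hsa : μa (Set.Icc (-(R - 1)) (R - 1))ᶜ = 0) (hsb : μb (Set.Icc (-(R - 1)) (R - 1))ᶜ = 0)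
    (hsc : μc (Set.Icc (-(R - 1)) (R - 1))ᶜ = 0)
    (hma : ∀ k : ℕ, 1 ≤ k → φ (a ^ k) = ((∫ x, x ^ k ∂μa : ℝ) : ℂ))
    (hmb : ∀ k : ℕ, 1 ≤ k → φ (b ^ k) = ((∫ x, x ^ k ∂μb : ℝ) : ℂ))
    (hmc : ∀ k : ℕ, 1 ≤ k → φ (c ^ k) = ((∫ x, x ^ k ∂μc : ℝ) : ℂ))
    (hRa : ‖a‖ + 1 ≤ R) (hRb : ‖b‖ + 1 ≤ R) (hRc : ‖c‖ + 1 ≤ R) :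
    0 ≤ hornBound n I R μa + hornBound n J R μb + hornBound n K R μc := by
  obtain ⟨H, _, _, _, M, T, π, Ω, hπM, hπ, hΩ⟩ := exists_gns_unitInterval A φ hpos htr h1
  have hR0 : 0 ≤ R := by linarith [norm_nonneg a]
  set C : ℝ := 3 * (1 + (R + (r : ℝ) / n)) with hC
  have hC0 : 0 < C := by positivity
  suffices h : ∀ δ : ℝ, 0 < δ → δ ≤ 1 →
      0 ≤ hornBound n I R μa + hornBound n J R μb + hornBound n K R μc + δ * C by
    refine le_of_forall_pos_le_add fun ε hε => ?_
    refine (h (min 1 (ε / C)) (lt_min one_pos (by positivity)) (min_le_left _ _)).trans ?_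
    gcongr
    exact (mul_le_mul_of_nonneg_right (min_le_right _ _) hC0.le).trans_eq (by field_simp)
  intro δ hδ hδ1
  obtain ⟨e, he, hbe⟩ := exists_flag_of_shift h1 hπM hπ hΩ ha hsa hma hRa hδ hδ1
  obtain ⟨f, hf, hbf⟩ := exists_flag_of_shift h1 hπM hπ hΩ hb hsb hmb hRb hδ hδ1
  obtain ⟨g, hg, hbg⟩ := exists_flag_of_shift h1 hπM hπ hΩ hc hsc hmc hRc hδ hδ1
  obtain ⟨p, hp, hpr, hpl⟩ := hP H M T e f g he hf hg δ hδ
  have hpr' := (Complex.le_def.1 hpr).1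
  rw [Complex.ofReal_re] at hpr'
  have i1 := hbe n I p hI hp (hIr ▸ hpr') fun l h h' => (hpl l h (hIr ▸ h')).1
  have i2 := hbf n J p hJ hp (hJr ▸ hpr') fun l h h' => (hpl l h (hJr ▸ h')).2.1
  have i3 := hbg n K p hK hp (hKr ▸ hpr') fun l h h' => (hpl l h (hKr ▸ h')).2.2
  rw [hIr] at i1
  rw [hJr] at i2
  rw [hKr] at i3
  have hsum : π (ContinuousMap.const unitInterval a + (δ : ℂ) • coordFn A) +
      π (ContinuousMap.const unitInterval b + (δ : ℂ) • coordFn A) +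
      π (ContinuousMap.const unitInterval c + (δ : ℂ) • coordFn A) =
      π ((3 * (δ : ℂ)) • coordFn A) := by
    rw [← _root_.map_add, ← _root_.map_add]
    congr 1
    ext t
    change (a + (δ : ℂ) • coordFn A t) + (b + (δ : ℂ) • coordFn A t) +
      (c + (δ : ℂ) • coordFn A t) = (3 * (δ : ℂ)) • coordFn A t
    rw [← zero_add ((3 * (δ : ℂ)) • coordFn A t), ← habc]
    module
  have hlow : -(3 * δ) ≤ T.reTr p (π ((3 * (δ : ℂ)) • coordFn A)) := by
    rw [T.reTr_apply]
    have hpn : ‖p‖ ≤ 1 := (IsStarProjection.mk hp.2.1 hp.2.2).norm_le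
    have e1 : ‖π ((3 * (δ : ℂ)) • coordFn A)‖ ≤ 3 * δ := by
      refine (NonUnitalStarAlgHom.norm_apply_le π _).trans ?_
      rw [norm_smul, norm_mul, Complex.norm_real, Real.norm_eq_abs, abs_of_pos hδ]
      have := norm_coordFn_le A
      norm_num
      nlinarith
    have e2 := (Complex.abs_re_le_norm _).trans ((T.norm_le_of_vector hΩ
      (p * π ((3 * (δ : ℂ)) • coordFn A))).trans (norm_mul_le _ _))
    have e3 : ‖p‖ * ‖π ((3 * (δ : ℂ)) • coordFn A)‖ ≤ 1 * (3 * δ) :=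
      mul_le_mul hpn e1 (norm_nonneg _) zero_le_one
    linarith [(abs_le.1 (e2.trans e3)).1]
  rw [← hsum, _root_.map_add, _root_.map_add] at hlow
  rw [hC]
  linarith

section

variable {μ : Measure ℝ} [IsProbabilityMeasure μ] {R : ℝ}

lemma eigFn_eq_integral (hs : μ (Set.Icc (-(R - 1)) (R - 1))ᶜ = 0) {t : ℝ}
    (ht : t ∈ Set.Ico (0 : ℝ) 1) :
    eigFn μ t = -R + ∫ x in Set.Ioc (-R) R, {y | t < μ.real (Set.Ioi y)}.indicator 1 x := by
  set S : Set ℝ := {y | t < μ.real (Set.Ioi y)} with hS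
  have hlow : ∀ {x y}, y ∈ S → x ≤ y → x ∈ S := fun {x y} hy hxy =>
    lt_of_lt_of_le hy (measureReal_mono (Set.Ioi_subset_Ioi hxy))
  have hmem : -R ∈ S := by
    have h1 : μ.real (Set.Ioi (-R)) = 1 := by
      rw [measureReal_def, (prob_compl_eq_zero_iff measurableSet_Ioi).1, ENNReal.toReal_one]
      refine measure_mono_null (Set.compl_subset_compl.2 fun s h => ?_) hs
      have := h.1
      simp only [Set.mem_Ioi]
      linarith
    rw [hS, Set.mem_ofPred_eq, h1]
    exact ht.2
  have hbd : ∀ y ∈ S, y ≤ R := by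
    intro y hy
    by_contra hlt
    push Not at hlt
    have h0 : μ.real (Set.Ioi y) = 0 := by
      rw [measureReal_def, measure_mono_null _ hs, ENNReal.toReal_zero]
      intro s hs' hs''
      have := hs''.2
      simp only [Set.mem_Ioi] at hs'
      linarith
    rw [hS, Set.mem_ofPred_eq, h0] at hy
    exact absurd ht.1 (not_le.2 hy)
  have hbdd : BddAbove S := ⟨R, hbd⟩
  have he : eigFn μ t = sSup S := rfl
  have hl : -R ≤ sSup S := le_csSup hbdd hmem
  have hu : sSup S ≤ R := csSup_le ⟨_, hmem⟩ hbd
  have hae : ∀ᵐ x ∂(volume.restrict (Set.Ioc (-R) R)),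
      S.indicator (1 : ℝ → ℝ) x = (Set.Iic (sSup S)).indicator 1 x := by
    refine ae_restrict_of_ae ?_
    filter_upwards [compl_mem_ae_iff.2 (measure_singleton (sSup S))] with x hx
    by_cases hxS : x ∈ S
    · rw [Set.indicator_of_mem hxS, Set.indicator_of_mem (Set.mem_Iic.2 (le_csSup hbdd hxS))]
    · rw [Set.indicator_of_notMem hxS, Set.indicator_of_notMem]
      intro hle
      obtain ⟨y, hy, hxy⟩ := exists_lt_of_lt_csSup ⟨_, hmem⟩ (lt_of_le_of_ne hle hx)
      exact hxS (hlow hy hxy.le)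
  rw [integral_congr_ae hae, integral_indicator_one measurableSet_Iic, he,
    measureReal_restrict_apply measurableSet_Iic, Set.inter_comm, Set.Ioc_inter_Iic,
    min_eq_right hu, Real.volume_real_Ioc_of_le hl]
  ring

lemma setIntegral_indicator_lt (α β g : ℝ) :
    ∫ t in Set.Ico α β, (if t < g then (1 : ℝ) else 0) = max 0 (min (β - α) (g - α)) := by
  have : (fun t => if t < g then (1 : ℝ) else 0) = (Set.Iio g).indicator 1 := by
    ext t; simp [Set.indicator_apply]
  rw [this, integral_indicator_one measurableSet_Iio,
    measureReal_restrict_apply measurableSet_Iio, Set.inter_comm, Set.Ico_inter_Iio,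
    Real.volume_real_Ico, max_comm, ← min_sub_sub_right]

lemma setIntegral_eigFn (hs : μ (Set.Icc (-(R - 1)) (R - 1))ᶜ = 0) (hR : 0 ≤ R) {α β : ℝ}
    (hα : 0 ≤ α) (hαβ : α ≤ β) (hβ : β ≤ 1) :
    IntegrableOn (eigFn μ) (Set.Ico α β) ∧ ∫ t in Set.Ico α β, eigFn μ t =
      -R * (β - α) + ∫ x in -R..R, max 0 (min (β - α) (μ.real (Set.Ioi x) - α)) := by
  set G : ℝ → ℝ := fun x => μ.real (Set.Ioi x) with hG
  have hGa : Antitone G := fun x y h => measureReal_mono (Set.Ioi_subset_Ioi h)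
  set g : ℝ → ℝ → ℝ := fun t x => if t < G x then 1 else 0 with hg
  have hgm : Measurable (Function.uncurry g) :=
    Measurable.ite (measurableSet_lt measurable_fst (hGa.measurable.comp measurable_snd))
      measurable_const measurable_const
  have hgi : Integrable (Function.uncurry g)
      ((volume.restrict (Set.Ico α β)).prod (volume.restrict (Set.Ioc (-R) R))) := by
    refine Integrable.of_bound hgm.aestronglyMeasurable 1 (Eventually.of_forall fun z => ?_)
    simp only [Function.uncurry, hg]
    split_ifs <;> simp
  have heq : ∀ t ∈ Set.Ico α β, eigFn μ t = -R + ∫ x in Set.Ioc (-R) R, g t x := by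
    intro t ht
    rw [eigFn_eq_integral hs ⟨hα.trans ht.1, ht.2.trans_le hβ⟩]
    rfl
  have hi : IntegrableOn (fun t => -R + ∫ x in Set.Ioc (-R) R, g t x) (Set.Ico α β) :=
    (integrable_const _).add hgi.integral_prod_left
  refine ⟨hi.congr_fun (fun t ht => (heq t ht).symm) measurableSet_Ico, ?_⟩
  have hgl : IntegrableOn (fun t => ∫ x in Set.Ioc (-R) R, g t x) (Set.Ico α β) :=
    hgi.integral_prod_left
  rw [setIntegral_congr_fun measurableSet_Ico heq,
    integral_add (integrable_const _) hgl, integral_integral_swap hgi,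
    setIntegral_const, Real.volume_real_Ico_of_le hαβ, smul_eq_mul, mul_comm,
    intervalIntegral.integral_of_le (by linarith)]
  simp only [hg, hG, setIntegral_indicator_lt]

/-- The integral of the eigenvalue function over `ω_S`. -/
theorem setIntegral_omegaSet (hs : μ (Set.Icc (-(R - 1)) (R - 1))ᶜ = 0) (hR : 0 ≤ R) {n : ℕ}
    (hn : 0 < n) {S : Finset ℕ} (hS : S ⊆ Finset.Icc 1 n) :
    ∫ t in omegaSet n S, eigFn μ t =
      -R * ((S.card : ℝ) / n) + ∫ x in -R..R, omegaLength n S (μ.real (Set.Ioi x)) := by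
  have hn' : (0 : ℝ) < n := by exact_mod_cast hn
  have hlen : ∀ i : ℕ, (i : ℝ) / n - ((i : ℝ) - 1) / n = 1 / n := fun i => by ring
  have hpiece : ∀ i ∈ S, _ := fun i hi => by
    have hi' := Finset.mem_Icc.1 (hS hi)
    have h1 : (1 : ℝ) ≤ i := by exact_mod_cast hi'.1
    have h2 : (i : ℝ) ≤ n := by exact_mod_cast hi'.2
    exact setIntegral_eigFn (α := ((i : ℝ) - 1) / n) (β := (i : ℝ) / n) hs hR
      (div_nonneg (by linarith) hn'.le) (by gcongr; linarith) ((div_le_one hn').2 h2)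
  have hdisj : (S : Set ℕ).Pairwise
      (Function.onFun Disjoint fun i : ℕ => Set.Ico (((i : ℝ) - 1) / n) ((i : ℝ) / n)) := by
    have : ∀ i j : ℕ, i < j →
        Disjoint (Set.Ico (((i : ℝ) - 1) / n) ((i : ℝ) / n))
          (Set.Ico (((j : ℝ) - 1) / n) ((j : ℝ) / n)) := by
      intro i j hij
      have : (i : ℝ) + 1 ≤ j := by exact_mod_cast hij
      have : (i : ℝ) / n ≤ ((j : ℝ) - 1) / n := by gcongr; linarith
      exact Set.disjoint_left.2 fun x hx hx' => by linarith [hx.2, hx'.1]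
    intro i _ j _ hij
    rcases lt_or_gt_of_ne hij with h | h
    · exact this i j h
    · exact (this j i h).symm
  have hGa : Antitone fun x => μ.real (Set.Ioi x) := fun x y h =>
    measureReal_mono (Set.Ioi_subset_Ioi h)
  rw [omegaSet, integral_biUnion_finset S (fun _ _ => measurableSet_Ico) hdisj
    fun i hi => (hpiece i hi).1, Finset.sum_congr rfl fun i hi => (hpiece i hi).2]
  simp only [hlen, omegaLength]
  rw [Finset.sum_add_distrib, intervalIntegral.integral_finsetSum]
  · rw [Finset.sum_const, nsmul_eq_mul]; ring
  · intro i _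
    refine Antitone.intervalIntegrable fun x y h => ?_
    have := hGa h
    simp only at this ⊢
    gcongr

lemma card_image_reverse {n : ℕ} {I : Finset ℕ} (hI : I ⊆ Finset.Icc 1 n) :
    Set.InjOn (fun x => n + 1 - x) (I : Set ℕ) := by
  intro x hx y hy h
  have hx' := Finset.mem_Icc.1 (hI hx)
  have hy' := Finset.mem_Icc.1 (hI hy)
  simp only at h
  omega

lemma omegaLength_reverse {n : ℕ} (hn : 0 < n) {I : Finset ℕ} (hI : I ⊆ Finset.Icc 1 n) (t : ℝ) :
    omegaLength n (I.image fun x => n + 1 - x) (1 - t) =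
      (I.card : ℝ) / n - omegaLength n I t := by
  have hn' : (0 : ℝ) < n := by exact_mod_cast hn
  rw [omegaLength, Finset.sum_image (card_image_reverse hI), omegaLength,
    div_eq_mul_one_div (I.card : ℝ), ← nsmul_eq_mul, ← Finset.sum_const, ← Finset.sum_sub_distrib]
  refine Finset.sum_congr rfl fun i hi => ?_
  have hi' := Finset.mem_Icc.1 (hI hi)
  have e1 : (1 - t) - (((n + 1 - i : ℕ) : ℝ) - 1) / n = 1 / n - (t - ((i : ℝ) - 1) / n) := by
    rw [Nat.cast_sub (by omega)]
    push_cast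
    field_simp
    ring
  rw [e1]
  have h0 : (0 : ℝ) ≤ 1 / n := by positivity
  generalize (1 : ℝ) / n = d at *
  generalize t - ((i : ℝ) - 1) / n = u at *
  rcases le_total u 0 with h | h
  · rw [min_eq_left (by linarith), min_eq_right (by linarith), max_eq_left h, max_eq_right h0,
      sub_zero]
  · rw [min_eq_right (by linarith)]
    rcases le_total d u with h' | h'
    · rw [min_eq_left h', max_eq_right h0, max_eq_left (by linarith), sub_self]
    · rw [min_eq_right h', max_eq_right h, max_eq_right (by linarith)]

theorem setIntegral_omegaSet_reverse (hs : μ (Set.Icc (-(R - 1)) (R - 1))ᶜ = 0) (hR : 0 ≤ R)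
    {n : ℕ} (hn : 0 < n) {I : Finset ℕ} (hI : I ⊆ Finset.Icc 1 n) :
    ∫ t in omegaSet n (I.image fun x => n + 1 - x), eigFn μ t = hornBound n I R μ := by
  have hI' : (I.image fun x => n + 1 - x) ⊆ Finset.Icc 1 n := by
    intro x hx
    obtain ⟨i, hi, rfl⟩ := Finset.mem_image.1 hx
    have := Finset.mem_Icc.1 (hI hi)
    exact Finset.mem_Icc.2 ⟨by omega, by omega⟩
  have hG : ∀ x, μ.real (Set.Ioi x) = 1 - μ.real (Set.Iic x) := fun x => by
    rw [← Set.compl_Iic, probReal_compl_eq_one_sub measurableSet_Iic]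
  have hmono : Monotone fun x => omegaLength n I (μ.real (Set.Iic x)) :=
    (monotone_omegaLength n I).comp (monotone_measureReal_Iic μ)
  rw [setIntegral_omegaSet hs hR hn hI', Finset.card_image_of_injOn (card_image_reverse hI)]
  simp only [hG, omegaLength_reverse hn hI]
  rw [intervalIntegral.integral_sub (by simp) hmono.intervalIntegrable,
    intervalIntegral.integral_const, hornBound, smul_eq_mul]
  ring

theorem setIntegral_omegaSet_le_neg (hs : μ (Set.Icc (-(R - 1)) (R - 1))ᶜ = 0) (hR : 0 ≤ R)
    {n : ℕ} (hn : 0 < n) {K : Finset ℕ} (hK : K ⊆ Finset.Icc 1 n) :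
    ∫ t in omegaSet n K, eigFn μ t ≤ -hornBound n K R (μ.map Neg.neg) := by
  have : IsProbabilityMeasure (μ.map Neg.neg) :=
    Measure.isProbabilityMeasure_map measurable_neg.aemeasurable
  have hGa : Antitone fun x => omegaLength n K (μ.real (Set.Ioi x)) := fun x y h =>
    monotone_omegaLength n K (measureReal_mono (Set.Ioi_subset_Ioi h))
  have hmono : Monotone fun x => omegaLength n K ((μ.map Neg.neg).real (Set.Iic x)) :=
    (monotone_omegaLength n K).comp (monotone_measureReal_Iic _)
  have h1 := intervalIntegral.integral_comp_neg (a := -R) (b := R)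
    (fun x => omegaLength n K (μ.real (Set.Ioi x)))
  rw [neg_neg] at h1
  have h2 : ∫ x in -R..R, omegaLength n K (μ.real (Set.Ioi (-x))) ≤
      ∫ x in -R..R, omegaLength n K ((μ.map Neg.neg).real (Set.Iic x)) := by
    refine intervalIntegral.integral_mono_on (by linarith)
      (Monotone.intervalIntegrable fun x y h => hGa (neg_le_neg h)) hmono.intervalIntegrable
      fun x _ => monotone_omegaLength n K ?_
    rw [map_measureReal_apply measurable_neg measurableSet_Iic]
    refine measureReal_mono fun s hs => ?_
    simp only [Set.mem_Ioi, Set.mem_preimage, Set.mem_Iic] at hs ⊢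
    linarith
  rw [setIntegral_omegaSet hs hR hn hK, hornBound]
  linarith

end

lemma PropertyP.propertyAP {n r : ℕ} {i j k : ℕ → ℕ} (h : PropertyP n r i j k) :
    PropertyAP n r i j k := by
  intro H _ _ _ M T e f g he hf hg ε hε
  obtain ⟨p, hp, hpr, hl⟩ := h H M T e f g he hf hg
  refine ⟨p, hp, ?_, hl⟩
  rw [hpr]
  exact Complex.real_le_real.2 (by linarith)

lemma mem_utilde_of_mem_ttilde {n r : ℕ} {t : Finset ℕ × Finset ℕ × Finset ℕ}
    (h : t ∈ Ttilde n r) : t ∈ Utilde n r := by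
  cases r with
  | zero => exact h
  | succ r => exact h.1

lemma isClosed_vonNeumannAlgebra {H : Type} [NormedAddCommGroup H] [InnerProductSpace ℂ H]
    [CompleteSpace H] (M : VonNeumannAlgebra H) :
    IsClosed (M.toStarSubalgebra : Set (H →L[ℂ] H)) := by
  have h : (M.toStarSubalgebra : Set (H →L[ℂ] H)) = M.carrier := rfl
  rw [h, ← M.centralizer_centralizer']
  exact Set.isClosed_centralizer _

end Paper

open MeasureTheory in
/-- If `(I,J,K) ∈ T̃ⁿ_r` has property `Pₙ` (or the approximate property `APₙ`), then for
all self-adjoint `a, b` in any finite von Neumann algebra `(M,τ)` (with spectral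
distributions `μ_a, μ_b, μ_{a+b}`), the corresponding Horn inequality
`∫_{ω_{σ(I)}} λ_a + ∫_{ω_{σ(J)}} λ_b ≥ ∫_{ω_K} λ_{a+b}` holds, where `σ = σₙ` is the
order-reversing permutation `i ↦ n+1−i`. -/
theorem horn_inequality_of_propertyP (n r : ℕ) (hr : 1 ≤ r) (hrn : r ≤ n)
    (Tr : Finset ℕ × Finset ℕ × Finset ℕ) (hTr : Tr ∈ Paper.Ttilde n r)
    (hP : Paper.PropertyP n r (Paper.elem Tr.1) (Paper.elem Tr.2.1) (Paper.elem Tr.2.2) ∨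
      Paper.PropertyAP n r (Paper.elem Tr.1) (Paper.elem Tr.2.1) (Paper.elem Tr.2.2))
    {H : Type} [NormedAddCommGroup H] [InnerProductSpace ℂ H] [CompleteSpace H]
    (M : VonNeumannAlgebra H) (T : Paper.TracialState M)
    (a b : H →L[ℂ] H) (haM : a ∈ M) (hbM : b ∈ M)
    (ha : IsSelfAdjoint a) (hb : IsSelfAdjoint b)
    -- the spectral distributions of a, b and a+b with respect to τ:
    (μa μb μc : Measure ℝ)
    [IsProbabilityMeasure μa] [IsProbabilityMeasure μb] [IsProbabilityMeasure μc]
    (hsa : ∃ R : ℝ, μa (Set.Icc (-R) R)ᶜ = 0)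
    (hsb : ∃ R : ℝ, μb (Set.Icc (-R) R)ᶜ = 0)
    (hsc : ∃ R : ℝ, μc (Set.Icc (-R) R)ᶜ = 0)
    (hma : ∀ k : ℕ, 1 ≤ k → T.τ (a ^ k) = ((∫ x, x ^ k ∂μa : ℝ) : ℂ))
    (hmb : ∀ k : ℕ, 1 ≤ k → T.τ (b ^ k) = ((∫ x, x ^ k ∂μb : ℝ) : ℂ))
    (hmc : ∀ k : ℕ, 1 ≤ k → T.τ ((a + b) ^ k) = ((∫ x, x ^ k ∂μc : ℝ) : ℂ)) :
    (∫ t in Paper.omegaSet n (Tr.1.image (fun x => n + 1 - x)), Paper.eigFn μa t) +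
      (∫ t in Paper.omegaSet n (Tr.2.1.image (fun x => n + 1 - x)), Paper.eigFn μb t) ≥
      ∫ t in Paper.omegaSet n Tr.2.2, Paper.eigFn μc t := by
  obtain ⟨hI, hJ, hK, hIr, hJr, hKr, -⟩ := Paper.mem_utilde_of_mem_ttilde hTr
  have hAP := hP.elim Paper.PropertyP.propertyAP id
  have hn : 0 < n := by omega
  let _ : CStarAlgebra M.toStarSubalgebra :=
    StarSubalgebra.cstarAlgebra _ (h_closed := Paper.isClosed_vonNeumannAlgebra M)
  let φ : M.toStarSubalgebra →ₗ[ℂ] ℂ :=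
    { toFun := fun x => T.τ x
      map_add' := fun x y => T.map_add x y
      map_smul' := fun c x => T.map_smul c x }
  let a' : M.toStarSubalgebra := ⟨a, haM⟩
  let b' : M.toStarSubalgebra := ⟨b, hbM⟩
  have ha' : IsSelfAdjoint a' := Subtype.ext ha
  have hb' : IsSelfAdjoint b' := Subtype.ext hb
  obtain ⟨Ra, hRa⟩ := hsa
  obtain ⟨Rb, hRb⟩ := hsb
  obtain ⟨Rc, hRc⟩ := hsc
  set R : ℝ := ‖a'‖ + ‖b'‖ + ‖-(a' + b')‖ + |Ra| + |Rb| + |Rc| + 1 with hR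
  have na := norm_nonneg a'
  have nb := norm_nonneg b'
  have nc := norm_nonneg (-(a' + b'))
  have pa := abs_nonneg Ra
  have pb := abs_nonneg Rb
  have pc := abs_nonneg Rc
  have hR0 : 0 ≤ R := by positivity
  have hmono : ∀ {μ : Measure ℝ} {R' : ℝ}, μ (Set.Icc (-R') R')ᶜ = 0 → R' ≤ R - 1 →
      μ (Set.Icc (-(R - 1)) (R - 1))ᶜ = 0 := fun h hle =>
    measure_mono_null
      (Set.compl_subset_compl.2 (Set.Icc_subset_Icc (neg_le_neg hle) hle)) h
  have hRa' := hmono hRa (by linarith [le_abs_self Ra])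
  have hRb' := hmono hRb (by linarith [le_abs_self Rb])
  have hRc' := hmono hRc (by linarith [le_abs_self Rc])
  have hprob : IsProbabilityMeasure (μc.map Neg.neg) :=
    Measure.isProbabilityMeasure_map measurable_neg.aemeasurable
  have hRn : (μc.map Neg.neg) (Set.Icc (-(R - 1)) (R - 1))ᶜ = 0 := by
    rw [Measure.map_apply measurable_neg measurableSet_Icc.compl, Set.preimage_compl]
    convert hRc' using 3
    rw [Set.neg_preimage, Set.neg_Icc, neg_neg]
  have hmn : ∀ k : ℕ, 1 ≤ k →
      φ ((-(a' + b')) ^ k) = ((∫ x, x ^ k ∂(μc.map Neg.neg) : ℝ) : ℂ) := by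
    intro k hk
    have e1 : φ ((-(a' + b')) ^ k) = (-1) ^ k * T.τ ((a + b) ^ k) := by
      rw [← neg_one_smul ℂ, smul_pow, _root_.map_smul, smul_eq_mul]
      rfl
    rw [e1, hmc k hk, integral_map measurable_neg.aemeasurable (by fun_prop)]
    rw [show (fun x : ℝ => (Neg.neg x) ^ k) = fun x => (-1) ^ k * x ^ k from
      funext fun x => neg_pow x k, integral_const_mul]
    push_cast
    rfl
  have key := Paper.hornBound_nonneg hI hJ hK hIr hJr hKr hAP φ
    (fun x => T.pos x x.2) (fun x y => T.tracial x y x.2 y.2) T.normalized ha' hb'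
    (ha'.add hb').neg (add_neg_cancel _) hRa' hRb' hRn hma hmb hmn
    (by linarith) (by linarith) (by linarith)
  have hc := Paper.setIntegral_omegaSet_le_neg hRc' hR0 hn hK
  rw [Paper.setIntegral_omegaSet_reverse hRa' hR0 hn hI,
    Paper.setIntegral_omegaSet_reverse hRb' hR0 hn hJ]
  linarith
end

section
/- The Littlewood–Richardson coefficient c⁽ⁿ⁾(I,J,K) of a triple of r-element subsets of {1,…,n} is invariant under all permutations of the three arguments I, J, K. -/
namespace Paper

open Finset

/-! ### Partitions in a box and chains of horizontal strips -/

/-- Partitions with at most `r` parts, all at most `N`, written as antitone sequences indexed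
from `1`, with the convention that the entry at `0` is `N`. -/
def IsBox (r N : ℕ) (a : ℕ → ℕ) : Prop :=
  a 0 = N ∧ Antitone a ∧ ∀ ℓ, r < ℓ → a ℓ = 0

/-- `b` is obtained from `a` by adding a horizontal strip. -/
def Interlace (a b : ℕ → ℕ) : Prop := ∀ ℓ, a ℓ ≤ b ℓ ∧ b (ℓ + 1) ≤ a ℓ

/-- Chains of length `M` of horizontal strips from `a` to `c`, continued constantly after the
index `M`. -/
def IsStripChain (r N M : ℕ) (a c : ℕ → ℕ) (g : ℕ → ℕ → ℕ) : Prop :=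
  g 0 = a ∧ (∀ k, M ≤ k → g k = c) ∧ (∀ k, IsBox r N (g k)) ∧ ∀ k, Interlace (g k) (g (k + 1))

theorem IsBox.le {r N : ℕ} {a : ℕ → ℕ} (h : IsBox r N a) (ℓ : ℕ) : a ℓ ≤ N :=
  h.1 ▸ h.2.1 (Nat.zero_le ℓ)

theorem IsBox.of_interlace {r N : ℕ} {a b c : ℕ → ℕ} (ha : IsBox r N a) (hc : IsBox r N c)
    (hab : Interlace a b) (hbc : Interlace b c) : IsBox r N b := by
  refine ⟨?_, antitone_nat_of_succ_le fun ℓ => ((hab ℓ).2.trans (hab ℓ).1), fun ℓ hℓ => ?_⟩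
  · have h1 := (hab 0).1
    have h2 := (hbc 0).1
    rw [ha.1] at h1
    rw [hc.1] at h2
    omega
  · have := (hbc ℓ).1
    rw [hc.2.2 ℓ hℓ] at this
    omega

theorem finite_isBox (r N : ℕ) : {a | IsBox r N a}.Finite := by
  have : Function.Injective (fun (a : {a | IsBox r N a}) (ℓ : Fin (r + 1)) =>
      (⟨a.1 ℓ, Nat.lt_succ_of_le (a.2.le ℓ)⟩ : Fin (N + 1))) := by
    rintro ⟨a, ha⟩ ⟨b, hb⟩ h
    refine Subtype.ext (funext fun ℓ => ?_)
    rcases Nat.lt_or_ge r ℓ with hℓ | hℓ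
    · exact (ha.2.2 ℓ hℓ).trans (hb.2.2 ℓ hℓ).symm
    · simpa using congrFun h ⟨ℓ, Nat.lt_succ_of_le hℓ⟩
  exact Finite.of_injective _ this

theorem finite_isStripChain (r N M : ℕ) (a c : ℕ → ℕ) : {g | IsStripChain r N M a c g}.Finite := by
  have := (finite_isBox r N).to_subtype
  have : Function.Injective (fun (g : {g | IsStripChain r N M a c g}) (k : Fin M) =>
      (⟨g.1 k, g.2.2.2.1 k⟩ : {a | IsBox r N a})) := by
    rintro ⟨g, hg⟩ ⟨g', hg'⟩ h
    refine Subtype.ext (funext fun k => ?_)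
    rcases Nat.lt_or_ge k M with hk | hk
    · simpa using congrFun h ⟨k, hk⟩
    · exact (hg.2.1 k hk).trans (hg'.2.1 k hk).symm
  exact Finite.of_injective _ this

/-- The finite set of partitions in the box. -/
noncomputable def boxes (r N : ℕ) : Finset (ℕ → ℕ) := (finite_isBox r N).toFinset

/-- The finite set of chains of horizontal strips. -/
noncomputable def stripChains (r N M : ℕ) (a c : ℕ → ℕ) : Finset (ℕ → ℕ → ℕ) :=
  (finite_isStripChain r N M a c).toFinset

@[simp] theorem mem_boxes {r N : ℕ} {a : ℕ → ℕ} : a ∈ boxes r N ↔ IsBox r N a := by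
  simp [boxes]

@[simp] theorem mem_stripChains {r N M : ℕ} {a c : ℕ → ℕ} {g : ℕ → ℕ → ℕ} :
    g ∈ stripChains r N M a c ↔ IsStripChain r N M a c g := by
  simp [stripChains]

/-- The sum of the parts of a boxed partition, shifted by the constant entry at `0`. -/
def size (r : ℕ) (a : ℕ → ℕ) : ℤ := ∑ ℓ ∈ range (r + 1), (a ℓ : ℤ)

/-- The sizes of the horizontal strips of a chain. -/
def wt (r : ℕ) {M : ℕ} (g : ℕ → ℕ → ℕ) (i : Fin M) : ℤ := size r (g (i + 1)) - size r (g i)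

/-! ### Toggling one partition of a chain -/

/-- The lower bound for a partition between `a` and `c`. -/
def lower (a c : ℕ → ℕ) (ℓ : ℕ) : ℕ := max (a ℓ) (c (ℓ + 1))

/-- The upper bound for a partition between `a` and `c`. -/
def upper (a c : ℕ → ℕ) (ℓ : ℕ) : ℕ := min (a (ℓ - 1)) (c ℓ)

theorem interlace_of_bounds {a b c : ℕ → ℕ}
    (h : ∀ ℓ, lower a c ℓ ≤ b ℓ ∧ b ℓ ≤ upper a c ℓ) : Interlace a b ∧ Interlace b c := by
  refine ⟨fun ℓ => ?_, fun ℓ => ?_⟩ <;> have h0 := h ℓ <;> have h1 := h (ℓ + 1) <;>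
    simp only [lower, upper, Nat.add_sub_cancel] at h0 h1 <;> omega

theorem bounds_of_interlace {r N : ℕ} {a b c : ℕ → ℕ} (ha : IsBox r N a) (hb : IsBox r N b)
    (hab : Interlace a b) (hbc : Interlace b c) (ℓ : ℕ) :
    lower a c ℓ ≤ b ℓ ∧ b ℓ ≤ upper a c ℓ := by
  have h1 := hab ℓ
  have h2 := hbc ℓ
  refine ⟨max_le h1.1 h2.2, le_min ?_ h2.1⟩
  cases ℓ with
  | zero => simp [ha.1, hb.1]
  | succ ℓ => exact (hab ℓ).2

theorem IsStripChain.update {r N M : ℕ} {a c : ℕ → ℕ} {g : ℕ → ℕ → ℕ}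
    (hg : IsStripChain r N M a c g) {k : ℕ} (hk : k + 2 ≤ M) {b : ℕ → ℕ}
    (hb : ∀ ℓ, lower (g k) (g (k + 2)) ℓ ≤ b ℓ ∧ b ℓ ≤ upper (g k) (g (k + 2)) ℓ) :
    IsStripChain r N M a c (Function.update g (k + 1) b) := by
  obtain ⟨h0, hM, hbox, hint⟩ := hg
  obtain ⟨h1, h2⟩ := interlace_of_bounds hb
  refine ⟨?_, fun j hj => ?_, fun j => ?_, fun j => ?_⟩
  · rw [Function.update_of_ne (by omega), h0]
  · rw [Function.update_of_ne (by omega), hM j hj]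
  · rcases eq_or_ne j (k + 1) with rfl | hj
    · rw [Function.update_self]
      exact (hbox k).of_interlace (hbox (k + 2)) h1 h2
    · rw [Function.update_of_ne hj]
      exact hbox j
  · rcases eq_or_ne j (k + 1) with rfl | hj
    · rwa [Function.update_self, Function.update_of_ne (by omega)]
    · rw [Function.update_of_ne hj]
      rcases eq_or_ne j k with rfl | hj'
      · rwa [Function.update_self]
      · rw [Function.update_of_ne (by omega)]
        exact hint j

theorem sum_lower_add_upper {r N : ℕ} {a c : ℕ → ℕ} (ha : IsBox r N a) (hc : IsBox r N c) (L : ℕ) :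
    ∑ ℓ ∈ range (L + 1), ((lower a c ℓ : ℤ) + upper a c ℓ) =
      ∑ ℓ ∈ range (L + 1), ((a ℓ : ℤ) + c ℓ) + (lower a c L - a L) := by
  induction L with
  | zero =>
    have := hc.le 1
    simp [lower, upper, ha.1, hc.1, this]
  | succ L ih =>
    rw [sum_range_succ, ih, sum_range_succ _ (L + 1)]
    simp only [lower, upper, Nat.add_sub_cancel]
    omega

theorem sum_lower_add_upper_eq_size {r N : ℕ} {a c : ℕ → ℕ} (ha : IsBox r N a)
    (hc : IsBox r N c) :
    ∑ ℓ ∈ range (r + 1), ((lower a c ℓ : ℤ) + upper a c ℓ) = size r a + size r c := by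
  rw [sum_lower_add_upper ha hc, sum_add_distrib, size, size]
  simp [lower, hc.2.2 (r + 1) (by omega)]

/-- Reflect every part of `b` in the interval of its admissible values. -/
def toggle (a c b : ℕ → ℕ) (ℓ : ℕ) : ℕ := lower a c ℓ + upper a c ℓ - b ℓ

theorem wt_update {r M : ℕ} (g : ℕ → ℕ → ℕ) {k : ℕ} (hk : k + 1 < M) (b : ℕ → ℕ) (d : ℤ)
    (hb : size r b = size r (g k) + size r (g (k + 2)) - size r (g (k + 1)) - d) (i : Fin M) :
    wt r (Function.update g (k + 1) b) i =
      wt r g (Equiv.swap (⟨k, by omega⟩ : Fin M) ⟨k + 1, hk⟩ i) +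
        (if (i : ℕ) = k then -d else if (i : ℕ) = k + 1 then d else 0) := by
  rcases eq_or_ne (i : ℕ) k with h | h
  · rw [show i = ⟨k, by omega⟩ from Fin.ext h, Equiv.swap_apply_left]
    simp [wt, hb]
    ring
  · rcases eq_or_ne (i : ℕ) (k + 1) with h' | h'
    · obtain rfl : i = ⟨k + 1, by omega⟩ := Fin.ext h'
      rw [Equiv.swap_apply_right]
      simp [wt, hb]
      ring
    · rw [Equiv.swap_apply_of_ne_of_ne (fun e => h (by simp [e])) (fun e => h' (by simp [e]))]
      simp [wt, h, h']

/-- Adjacent strip sizes can be exchanged by toggling (the Bender–Knuth involution). -/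
theorem sum_stripChains_swap {r N M : ℕ} (a c : ℕ → ℕ) {k : ℕ} (hk : k + 1 < M)
    (φ : (Fin M → ℤ) → ℤ) :
    ∑ g ∈ stripChains r N M a c, φ (wt r g) =
      ∑ g ∈ stripChains r N M a c,
        φ (wt r g ∘ Equiv.swap (⟨k, by omega⟩ : Fin M) ⟨k + 1, hk⟩) := by
  set F : (ℕ → ℕ → ℕ) → (ℕ → ℕ → ℕ) := fun g =>
    Function.update g (k + 1) (toggle (g k) (g (k + 2)) (g (k + 1))) with hF
  have hbd : ∀ g ∈ stripChains r N M a c, ∀ ℓ,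
      lower (g k) (g (k + 2)) ℓ ≤ g (k + 1) ℓ ∧ g (k + 1) ℓ ≤ upper (g k) (g (k + 2)) ℓ := by
    intro g hg
    obtain ⟨-, -, hbox, hint⟩ := mem_stripChains.1 hg
    exact bounds_of_interlace (hbox k) (hbox _) (hint k) (hint (k + 1))
  have hmem : ∀ g ∈ stripChains r N M a c, F g ∈ stripChains r N M a c := by
    intro g hg
    refine mem_stripChains.2 ((mem_stripChains.1 hg).update hk fun ℓ => ?_)
    have := hbd g hg ℓ
    simp only [toggle]
    omega
  have hinv : ∀ g ∈ stripChains r N M a c, F (F g) = g := by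
    intro g hg
    have : toggle (g k) (g (k + 2)) (toggle (g k) (g (k + 2)) (g (k + 1))) = g (k + 1) := by
      funext ℓ
      have := hbd g hg ℓ
      simp only [toggle]
      omega
    simp [hF, this]
  refine (sum_nbij' F F hmem hmem hinv hinv fun g hg => ?_).symm
  congr 1
  funext i
  obtain ⟨-, -, hbox, hint⟩ := mem_stripChains.1 hg
  rw [wt_update g hk _ 0 _ i]
  · simp
  · rw [← sum_lower_add_upper_eq_size (hbox k) (hbox (k + 2)), size, size, sub_zero,
      ← sum_sub_distrib]
    refine sum_congr rfl fun ℓ _ => ?_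
    have := hbd g hg ℓ
    simp only [toggle]
    omega

theorem sum_stripChains_perm {r N M : ℕ} (a c : ℕ → ℕ) (π : Equiv.Perm (Fin M))
    (φ : (Fin M → ℤ) → ℤ) :
    ∑ g ∈ stripChains r N M a c, φ (wt r g) =
      ∑ g ∈ stripChains r N M a c, φ (wt r g ∘ π) := by
  cases M with
  | zero =>
    refine sum_congr rfl fun g _ => congrArg φ (Subsingleton.elim _ _)
  | succ n =>
    have hπ : π ∈ Submonoid.closure (Set.range fun i : Fin n => Equiv.swap i.castSucc i.succ) := by
      rw [Equiv.Perm.mclosure_swap_castSucc_succ]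
      trivial
    induction hπ using Submonoid.closure_induction generalizing φ with
    | mem x hx =>
      obtain ⟨i, rfl⟩ := hx
      exact sum_stripChains_swap a c (Nat.succ_lt_succ i.2) φ
    | one => rfl
    | mul x y _ _ hx hy =>
      rw [hy φ, hx fun w => φ (w ∘ y)]
      rfl

/-! ### Concatenation and complementation of chains -/

theorem sum_stripChains_add {r N M₁ M₂ : ℕ} {a c : ℕ → ℕ} (F : (Fin M₁ → ℤ) → ℤ)
    (H : (Fin M₂ → ℤ) → ℤ) :
    ∑ g ∈ stripChains r N (M₁ + M₂) a c,
        F (fun i => wt r g (Fin.castAdd M₂ i)) * H (fun i => wt r g (Fin.natAdd M₁ i)) =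
      ∑ κ ∈ boxes r N, (∑ g ∈ stripChains r N M₁ a κ, F (wt r g)) *
        ∑ g ∈ stripChains r N M₂ κ c, H (wt r g) := by
  classical
  rw [← sum_fiberwise_of_maps_to (t := boxes r N) (g := fun g => g M₁)
    fun g hg => mem_boxes.2 ((mem_stripChains.1 hg).2.2.1 M₁)]
  refine sum_congr rfl fun κ _ => ?_
  rw [sum_mul_sum, ← sum_product']
  refine sum_nbij' (fun g => (fun k => g (min k M₁), fun k => g (M₁ + k)))
    (fun p k => if k ≤ M₁ then p.1 k else p.2 (k - M₁)) ?_ ?_ ?_ ?_ ?_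
  · intro g hg
    obtain ⟨hg, hκ⟩ := mem_filter.1 hg
    obtain ⟨h0, hM, hbox, hint⟩ := mem_stripChains.1 hg
    refine mem_product.2 ⟨mem_stripChains.2 ⟨by simp [h0], fun k hk => by simp [hk, hκ],
      fun k => hbox _, fun k => ?_⟩, mem_stripChains.2 ⟨hκ, fun k hk => hM _ (by omega),
      fun k => hbox _, fun k => hint _⟩⟩
    rcases Nat.lt_or_ge k M₁ with hk | hk
    · simpa [min_eq_left hk.le, min_eq_left (Nat.succ_le_of_lt hk)] using hint k
    · simp only [min_eq_right hk, min_eq_right (hk.trans k.le_succ)]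
      exact fun ℓ => ⟨le_rfl, (hbox M₁).2.1 ℓ.le_succ⟩
  · rintro ⟨g₁, g₂⟩ hp
    obtain ⟨h₁, h₂⟩ := mem_product.1 hp
    obtain ⟨h0, hM, hbox, hint⟩ := mem_stripChains.1 h₁
    obtain ⟨h0', hM', hbox', hint'⟩ := mem_stripChains.1 h₂
    dsimp only at h0 hM hbox hint h0' hM' hbox' hint'
    refine mem_filter.2 ⟨mem_stripChains.2 ⟨by simpa using h0, fun k hk => ?_, fun k => ?_,
      fun k => ?_⟩, by simp [hM]⟩
    · rcases Nat.lt_or_ge M₁ k with hk' | hk'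
      · simpa [not_le.2 hk'] using hM' _ (by omega)
      · obtain rfl : M₂ = 0 := by omega
        obtain rfl : k = M₁ := by omega
        simp only [le_refl, if_true]
        rw [hM _ le_rfl, ← h0', hM' 0 le_rfl]
    · dsimp only
      split_ifs
      exacts [hbox _, hbox' _]
    · dsimp only
      rcases lt_trichotomy k M₁ with hk | rfl | hk
      · simpa [hk.le, Nat.succ_le_of_lt hk] using hint k
      · have := hint' 0
        rw [h0', ← hM k le_rfl] at this
        simpa using this
      · rw [if_neg (by omega), if_neg (by omega), Nat.sub_add_comm hk.le]
        exact hint' _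
  · intro g hg
    funext k
    dsimp only
    split_ifs with hk
    · rw [min_eq_left hk]
    · rw [Nat.add_sub_cancel' (by omega)]
  · rintro ⟨g₁, g₂⟩ hp
    obtain ⟨h₁, h₂⟩ := mem_product.1 hp
    obtain ⟨h0, hM, hbox, hint⟩ := mem_stripChains.1 h₁
    obtain ⟨h0', hM', hbox', hint'⟩ := mem_stripChains.1 h₂
    dsimp only at *
    refine Prod.ext (funext fun k => ?_) (funext fun k => ?_)
    · rcases Nat.le_total k M₁ with hk | hk
      · simp [hk]
      · simp [hk, hM]
    · cases k with
      | zero => simp [h0', hM]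
      | succ k => simp
  · intro g hg
    congr 2
    funext i
    simp [wt]

/-- The complement of a partition in the box. -/
def boxCompl (r N : ℕ) (a : ℕ → ℕ) (ℓ : ℕ) : ℕ := N - a (r + 1 - ℓ)

theorem IsBox.boxCompl {r N : ℕ} {a : ℕ → ℕ} (ha : IsBox r N a) : IsBox r N (boxCompl r N a) := by
  refine ⟨?_, fun i j hij => Nat.sub_le_sub_left (ha.2.1 (by omega)) N, fun ℓ hℓ => ?_⟩
  · simp [Paper.boxCompl, ha.2.2 (r + 1)]
  · simp [Paper.boxCompl, show r + 1 - ℓ = 0 by omega, ha.1]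

theorem boxCompl_boxCompl {r N : ℕ} {a : ℕ → ℕ} (ha : IsBox r N a) :
    boxCompl r N (boxCompl r N a) = a := by
  funext ℓ
  rcases Nat.le_total ℓ (r + 1) with h | h
  · have := ha.le ℓ
    simp only [boxCompl, Nat.sub_sub_self h]
    omega
  · simp only [boxCompl]
    rw [show r + 1 - ℓ = 0 by omega, Nat.sub_zero, ha.2.2 (r + 1) (by omega),
      ha.2.2 ℓ (by omega)]
    omega

theorem size_boxCompl {r N : ℕ} {a : ℕ → ℕ} (ha : IsBox r N a) :
    size r (boxCompl r N a) = (r + 2) * N - size r a := by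
  have h1 : ∑ ℓ ∈ range (r + 2), (boxCompl r N a ℓ : ℤ) = ∑ ℓ ∈ range (r + 2), ((N : ℤ) - a ℓ) := by
    rw [← sum_range_reflect]
    refine sum_congr rfl fun ℓ hℓ => ?_
    have hℓ := mem_range.1 hℓ
    have := ha.le ℓ
    simp only [boxCompl]
    rw [show r + 1 - (r + 2 - 1 - ℓ) = ℓ by omega]
    omega
  rw [sum_range_succ, sum_range_succ _ (r + 1), sum_sub_distrib] at h1
  simp only [boxCompl, Nat.sub_self, ha.1, ha.2.2 (r + 1) (by omega)] at h1
  simp only [sum_const, card_range, nsmul_eq_mul] at h1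
  simp only [size, boxCompl]
  push_cast at h1 ⊢
  linarith

theorem Interlace.boxCompl {r N : ℕ} {a b : ℕ → ℕ} (ha : IsBox r N a)
    (h : Interlace a b) : Interlace (boxCompl r N b) (boxCompl r N a) := by
  intro ℓ
  refine ⟨Nat.sub_le_sub_left (h _).1 N, ?_⟩
  simp only [Paper.boxCompl]
  rcases Nat.lt_or_ge r ℓ with hℓ | hℓ
  · rw [show r + 1 - (ℓ + 1) = 0 by omega, ha.1]
    omega
  · rw [show r + 1 - ℓ = r - ℓ + 1 by omega, show r + 1 - (ℓ + 1) = r - ℓ by omega]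
    exact Nat.sub_le_sub_left (h _).2 N

theorem IsStripChain.boxCompl {r N M : ℕ} {a c : ℕ → ℕ} {g : ℕ → ℕ → ℕ}
    (hg : IsStripChain r N M a c g) :
    IsStripChain r N M (boxCompl r N c) (boxCompl r N a) (fun k => boxCompl r N (g (M - k))) := by
  obtain ⟨h0, hM, hbox, hint⟩ := hg
  refine ⟨by simp [hM], fun k hk => by simp [Nat.sub_eq_zero_of_le hk, h0],
    fun k => (hbox _).boxCompl, fun k => ?_⟩
  rcases Nat.lt_or_ge k M with hk | hk
  · have := (hint (M - (k + 1))).boxCompl (hbox _)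
    rwa [show M - (k + 1) + 1 = M - k by omega] at this
  · dsimp only
    rw [Nat.sub_eq_zero_of_le hk, Nat.sub_eq_zero_of_le (hk.trans k.le_succ)]
    exact fun ℓ => ⟨le_rfl, (hbox 0).boxCompl.2.1 ℓ.le_succ⟩

theorem sum_stripChains_boxCompl {r N M : ℕ} {a c : ℕ → ℕ} (ha : IsBox r N a) (hc : IsBox r N c)
    (φ : (Fin M → ℤ) → ℤ) :
    ∑ g ∈ stripChains r N M a c, φ (wt r g) =
      ∑ g ∈ stripChains r N M (boxCompl r N c) (boxCompl r N a), φ (wt r g) := by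
  rw [sum_stripChains_perm (boxCompl r N c) _ Fin.revPerm]
  have hinv : ∀ a' c' : ℕ → ℕ, ∀ g ∈ stripChains r N M a' c',
      (fun k => boxCompl r N (boxCompl r N (g (M - (M - k))))) = g := by
    intro a' c' g hg
    obtain ⟨-, hM, hbox, -⟩ := mem_stripChains.1 hg
    funext k
    rw [boxCompl_boxCompl (hbox _)]
    rcases Nat.le_total k M with hk | hk
    · rw [Nat.sub_sub_self hk]
    · rw [Nat.sub_eq_zero_of_le hk, Nat.sub_zero, hM _ le_rfl, hM _ hk]
  refine sum_nbij' (fun g k => boxCompl r N (g (M - k))) (fun g k => boxCompl r N (g (M - k)))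
    (fun g hg => mem_stripChains.2 (mem_stripChains.1 hg).boxCompl) (fun g hg => ?_)
    (hinv _ _) (hinv _ _) fun g hg => ?_
  · have := (mem_stripChains.1 hg).boxCompl
    rw [boxCompl_boxCompl ha, boxCompl_boxCompl hc] at this
    exact mem_stripChains.2 this
  · obtain ⟨-, -, hbox, -⟩ := mem_stripChains.1 hg
    congr 1
    funext i
    have := i.2
    simp only [wt, Function.comp_apply, Fin.revPerm_apply, Fin.val_rev, size_boxCompl (hbox _)]
    rw [show M - (M - (↑i + 1) + 1) = (i : ℕ) by omega,
      show M - (M - (↑i + 1)) = (i : ℕ) + 1 by omega]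
    ring

/-! ### The alternating weight and the sign-reversing involution -/

/-- The alternating sum over permutations `σ` of the indicators of `w i - i = μ (σ i) - σ i`. -/
def altWeight (r : ℕ) (μ : ℕ → ℕ) (w : Fin r → ℤ) : ℤ :=
  Matrix.det (Matrix.of fun i j : Fin r =>
    if w i - (i : ℕ) = (μ (j + 1) : ℤ) - (j : ℕ) then (1 : ℤ) else 0)

theorem altWeight_of_antitone {r : ℕ} {μ : ℕ → ℕ} (hμ : Antitone μ) {w : Fin r → ℤ}
    (hw : Antitone w) : altWeight r μ w = if ∀ i, w i = μ (i + 1) then 1 else 0 := by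
  have hμ' : StrictAnti fun j : Fin r => (μ (j + 1) : ℤ) - (j : ℕ) := by
    intro i j hij
    have h1 : μ (j + 1) ≤ μ (i + 1) := hμ (by simpa using hij.le)
    have h2 : (i : ℕ) < j := hij
    dsimp only
    omega
  split_ifs with h
  · refine Eq.trans (congrArg Matrix.det ?_) Matrix.det_one
    ext i j
    simp only [Matrix.of_apply, Matrix.one_apply, h]
    exact if_congr hμ'.injective.eq_iff rfl rfl
  · rw [altWeight, Matrix.det_apply]
    refine sum_eq_zero fun σ _ => ?_
    by_contra hne
    have hσ : ∀ i, w (σ i) - (σ i : ℕ) = (μ (i + 1) : ℤ) - (i : ℕ) := by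
      intro i
      by_contra hi
      refine hne ?_
      rw [prod_eq_zero (mem_univ i) (by simp [hi]), smul_zero]
    have hmono : StrictMono σ := by
      intro i j hij
      have h1 := hμ' hij
      simp only [← hσ] at h1
      by_contra hle
      have h2 := hw (not_lt.1 hle)
      have h3 : (σ j : ℕ) ≤ σ i := not_lt.1 hle
      omega
    have hid : ∀ i, σ i = i := fun i => by
      have := Subsingleton.elim (hmono.orderIsoOfSurjective σ σ.surjective) (OrderIso.refl _)
      exact DFunLike.congr_fun this i
    exact h fun i => by simpa [hid] using hσ i

theorem altWeight_swap {r : ℕ} (μ : ℕ → ℕ) {w w' : Fin r → ℤ} {k l : Fin r} (hkl : k ≠ l)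
    (h : ∀ i, w' i - (i : ℕ) = w (Equiv.swap k l i) - (Equiv.swap k l i : ℕ)) :
    altWeight r μ w' = -altWeight r μ w := by
  have : (Matrix.of fun i j : Fin r =>
      if w' i - (i : ℕ) = (μ (j + 1) : ℤ) - (j : ℕ) then (1 : ℤ) else 0) =
      (Matrix.of fun i j : Fin r =>
        if w i - (i : ℕ) = (μ (j + 1) : ℤ) - (j : ℕ) then (1 : ℤ) else 0).submatrix
          (Equiv.swap k l) id := by
    ext i j
    simp [h]
  rw [altWeight, this, Matrix.det_permute, Equiv.Perm.sign_swap hkl]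
  simp [altWeight]

/-- The number of entries of the second strip in the rows up to `L`, minus the number of entries
of the first strip in the rows before `L`. -/
def excess (a b c : ℕ → ℕ) (L : ℕ) : ℤ :=
  ∑ ℓ ∈ range (L + 1), ((c ℓ : ℤ) - b ℓ) - ∑ ℓ ∈ range L, ((b ℓ : ℤ) - a ℓ)

theorem excess_congr {a b c a' b' c' : ℕ → ℕ} {L : ℕ} (ha : ∀ ℓ < L, a ℓ = a' ℓ)
    (hb : ∀ ℓ ≤ L, b ℓ = b' ℓ) (hc : ∀ ℓ ≤ L, c ℓ = c' ℓ) :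
    excess a b c L = excess a' b' c' L := by
  refine congrArg₂ _ (sum_congr rfl fun ℓ hℓ => ?_) (sum_congr rfl fun ℓ hℓ => ?_)
  · have := mem_range.1 hℓ
    rw [hb ℓ (by omega), hc ℓ (by omega)]
  · have := mem_range.1 hℓ
    rw [hb ℓ (by omega), ha ℓ (by omega)]

theorem excess_eq {r N : ℕ} {a c : ℕ → ℕ} (ha : IsBox r N a) (hc : IsBox r N c) (b : ℕ → ℕ)
    (L : ℕ) : excess a b c L =
      ∑ ℓ ∈ range L, ((lower a c ℓ : ℤ) + upper a c ℓ - 2 * b ℓ) + (upper a c L - b L) := by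
  have h := sum_lower_add_upper ha hc L
  rw [sum_range_succ, sum_range_succ] at h
  simp only [sum_add_distrib] at h
  rw [excess, sum_range_succ]
  simp only [sum_sub_distrib, sum_add_distrib, ← mul_sum]
  linarith

/-- The partial reflection of `b` which exchanges the free entries of the two strips after the
first violation of the lattice condition, in row `L`. -/
def partialToggle (a c b : ℕ → ℕ) (L ℓ : ℕ) : ℕ :=
  if ℓ < L then b ℓ
  else if ℓ = L then lower a c L + (excess a b c L - 1).toNat
  else toggle a c b ℓ

theorem partialToggle_bounds {r N : ℕ} {a b c : ℕ → ℕ} (ha : IsBox r N a) (hb : IsBox r N b)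
    (hc : IsBox r N c) (hab : Interlace a b) (hbc : Interlace b c) {L : ℕ}
    (hL : 0 < excess a b c L) (hlt : ∀ L' < L, excess a b c L' ≤ 0) (ℓ : ℕ) :
    lower a c ℓ ≤ partialToggle a c b L ℓ ∧ partialToggle a c b L ℓ ≤ upper a c ℓ := by
  have h := bounds_of_interlace ha hb hab hbc
  have hℓ := h ℓ
  rw [partialToggle]
  split_ifs with h1 h2
  · exact hℓ
  · subst h2
    refine ⟨by omega, ?_⟩
    have hs : ∑ m ∈ range ℓ, ((lower a c m : ℤ) + upper a c m - 2 * b m) ≤ 0 := by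
      cases ℓ with
      | zero => simp
      | succ m =>
        have := hlt m (by omega)
        rw [excess_eq ha hc] at this
        have hm := h m
        rw [sum_range_succ]
        omega
    have := excess_eq ha hc b ℓ
    omega
  · simp only [toggle]
    omega

theorem partialToggle_self {r N : ℕ} {a b c : ℕ → ℕ} (ha : IsBox r N a)
    (hc : IsBox r N c) {L : ℕ} (hL : 0 < excess a b c L) :
    (partialToggle a c b L L : ℤ) = lower a c L + upper a c L - b L - 1 +
      ∑ ℓ ∈ range L, ((lower a c ℓ : ℤ) + upper a c ℓ - 2 * b ℓ) := by
  have := excess_eq ha hc b L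
  simp only [partialToggle, lt_irrefl, if_false, if_true]
  omega

theorem excess_partialToggle {r N : ℕ} {a b c : ℕ → ℕ} (ha : IsBox r N a)
    (hc : IsBox r N c) {L : ℕ} (hL : 0 < excess a b c L) :
    excess a (partialToggle a c b L) c L = b L - lower a c L + 1 := by
  rw [excess_eq ha hc, partialToggle_self ha hc hL]
  have : ∑ ℓ ∈ range L, ((lower a c ℓ : ℤ) + upper a c ℓ - 2 * partialToggle a c b L ℓ) =
      ∑ ℓ ∈ range L, ((lower a c ℓ : ℤ) + upper a c ℓ - 2 * b ℓ) :=
    sum_congr rfl fun ℓ hℓ => by simp [partialToggle, mem_range.1 hℓ]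
  rw [this]
  ring

theorem partialToggle_partialToggle {r N : ℕ} {a b c : ℕ → ℕ} (ha : IsBox r N a)
    (hb : IsBox r N b) (hc : IsBox r N c) (hab : Interlace a b) (hbc : Interlace b c) {L : ℕ}
    (hL : 0 < excess a b c L) :
    partialToggle a c (partialToggle a c b L) L = b := by
  funext ℓ
  have hℓ := bounds_of_interlace ha hb hab hbc ℓ
  rcases lt_trichotomy ℓ L with h | rfl | h
  · simp [partialToggle, h]
  · have := excess_partialToggle ha hc hL
    rw [partialToggle, if_neg (lt_irrefl _), if_pos rfl, this]
    omega
  · have h1 : ¬ℓ < L := by omega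
    have h2 : ℓ ≠ L := by omega
    simp only [partialToggle, h1, h2, if_false, toggle]
    omega

theorem size_partialToggle {r N : ℕ} {a b c : ℕ → ℕ} (ha : IsBox r N a) (hb : IsBox r N b)
    (hc : IsBox r N c) (hab : Interlace a b) (hbc : Interlace b c) {L : ℕ} (hLr : L ≤ r)
    (hL : 0 < excess a b c L) :
    size r (partialToggle a c b L) = size r a + size r c - size r b - 1 := by
  have h := bounds_of_interlace ha hb hab hbc
  have key : ∀ n, L + 1 ≤ n → ∑ ℓ ∈ range n, (partialToggle a c b L ℓ : ℤ) =
      ∑ ℓ ∈ range n, ((lower a c ℓ : ℤ) + upper a c ℓ - b ℓ) - 1 := by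
    intro n hn
    induction n, hn using Nat.le_induction with
    | base =>
      have : ∑ ℓ ∈ range L, (partialToggle a c b L ℓ : ℤ) = ∑ ℓ ∈ range L, (b ℓ : ℤ) :=
        sum_congr rfl fun ℓ hℓ => by simp [partialToggle, mem_range.1 hℓ]
      rw [sum_range_succ, sum_range_succ, partialToggle_self ha hc hL, this]
      simp only [sum_sub_distrib, sum_add_distrib, ← mul_sum]
      ring
    | succ n hn ih =>
      have hbn := h n
      have : partialToggle a c b L n = toggle a c b n := by
        rw [partialToggle, if_neg (by omega), if_neg (by omega)]
      rw [sum_range_succ, ih, sum_range_succ _ n, this]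
      simp only [toggle]
      omega
  rw [← sum_lower_add_upper_eq_size ha hc, size, key _ (by omega), size, sum_sub_distrib]

/-- The lattice condition is violated in row `L` for the strips `k` and `k + 1`. -/
def Violates (r : ℕ) (g : ℕ → ℕ → ℕ) (k L : ℕ) : Prop :=
  k + 2 ≤ r ∧ L ≤ r ∧ 0 < excess (g k) (g (k + 1)) (g (k + 2)) L

/-- All lattice conditions hold. -/
def IsLattice (r : ℕ) (g : ℕ → ℕ → ℕ) : Prop := ∀ k L, ¬Violates r g k L

/-- The first violation in the reading order: rows from top to bottom, and larger entries
first in each row. -/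
def FirstViolation (r : ℕ) (g : ℕ → ℕ → ℕ) (p : ℕ × ℕ) : Prop :=
  Violates r g p.1 p.2 ∧ (∀ k, ∀ L < p.2, ¬Violates r g k L) ∧ ∀ k > p.1, ¬Violates r g k p.2

theorem exists_firstViolation {r : ℕ} {g : ℕ → ℕ → ℕ} (h : ¬IsLattice r g) :
    ∃ p, FirstViolation r g p := by
  classical
  simp only [IsLattice, not_forall, not_not] at h
  have h' : ∃ L, ∃ k, Violates r g k L := let ⟨k, L, h⟩ := h; ⟨L, k, h⟩
  obtain ⟨k, hk⟩ := Nat.find_spec h'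
  refine ⟨(Nat.findGreatest (fun k => Violates r g k (Nat.find h')) r, Nat.find h'),
    Nat.findGreatest_spec (P := fun k => Violates r g k (Nat.find h'))
      (by have := hk.1; omega : k ≤ r) hk,
    fun k L hL hk => Nat.find_min h' hL ⟨k, hk⟩, fun k hk hv => ?_⟩
  have := hv.1
  exact Nat.findGreatest_is_greatest hk (by omega) hv

theorem FirstViolation.unique {r : ℕ} {g : ℕ → ℕ → ℕ} {p q : ℕ × ℕ} (hp : FirstViolation r g p)
    (hq : FirstViolation r g q) : p = q := by
  have h2 : p.2 = q.2 := le_antisymm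
    (not_lt.1 fun h => hp.2.1 _ _ h hq.1) (not_lt.1 fun h => hq.2.1 _ _ h hp.1)
  refine Prod.ext (le_antisymm ?_ ?_) h2
  · exact not_lt.1 fun h => hq.2.2 _ h (h2 ▸ hp.1)
  · exact not_lt.1 fun h => hp.2.2 _ h (h2 ▸ hq.1)

/-- Partially toggle a chain at a given position. -/
def toggleAt (g : ℕ → ℕ → ℕ) (p : ℕ × ℕ) : ℕ → ℕ → ℕ :=
  Function.update g (p.1 + 1) (partialToggle (g p.1) (g (p.1 + 2)) (g (p.1 + 1)) p.2)

theorem toggleAt_of_lt (g : ℕ → ℕ → ℕ) (p : ℕ × ℕ) (k : ℕ) {ℓ : ℕ} (h : ℓ < p.2) :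
    toggleAt g p k ℓ = g k ℓ := by
  rcases eq_or_ne k (p.1 + 1) with rfl | hk
  · simp [toggleAt, partialToggle, h]
  · simp [toggleAt, hk]

theorem toggleAt_of_ne (g : ℕ → ℕ → ℕ) (p : ℕ × ℕ) {k : ℕ} (h : k ≠ p.1 + 1) :
    toggleAt g p k = g k := Function.update_of_ne h _ _

theorem toggleAt_self (g : ℕ → ℕ → ℕ) (p : ℕ × ℕ) : toggleAt g p (p.1 + 1) =
    partialToggle (g p.1) (g (p.1 + 2)) (g (p.1 + 1)) p.2 := Function.update_self _ _ _

section

variable {r N : ℕ} {a c : ℕ → ℕ} {g : ℕ → ℕ → ℕ} {p : ℕ × ℕ}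

theorem IsStripChain.toggleAt (hg : IsStripChain r N r a c g) (hp : FirstViolation r g p) :
    IsStripChain r N r a c (toggleAt g p) := by
  have hbox := hg.2.2.1
  have hint := hg.2.2.2
  refine hg.update hp.1.1 (partialToggle_bounds (hbox _) (hbox _) (hbox _) (hint _) (hint _)
    hp.1.2.2 fun L hL => not_lt.1 fun h => ?_)
  exact hp.2.1 _ _ hL ⟨hp.1.1, hL.le.trans hp.1.2.1, h⟩

theorem IsStripChain.firstViolation_toggleAt (hg : IsStripChain r N r a c g)
    (hp : FirstViolation r g p) : FirstViolation r (Paper.toggleAt g p) p := by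
  obtain ⟨-, -, hbox, hint⟩ := hg
  refine ⟨⟨hp.1.1, hp.1.2.1, ?_⟩, fun k L hL h => hp.2.1 k L hL ?_, fun k hk h => hp.2.2 k hk ?_⟩
  · rw [toggleAt_of_ne (k := p.1) _ _ (by omega), toggleAt_of_ne (k := p.1 + 2) _ _ (by omega),
      toggleAt_self, excess_partialToggle (hbox _) (hbox _) hp.1.2.2]
    have := bounds_of_interlace (c := g (p.1 + 2)) (hbox p.1) (hbox _) (hint _) (hint _) p.2
    omega
  · rwa [Violates, ← excess_congr (fun ℓ hℓ => toggleAt_of_lt g p _ (hℓ.trans hL))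
      (fun ℓ hℓ => toggleAt_of_lt g p _ (hℓ.trans_lt hL))
      (fun ℓ hℓ => toggleAt_of_lt g p _ (hℓ.trans_lt hL))]
  · rwa [Violates, ← excess_congr (fun ℓ hℓ => toggleAt_of_lt g p k hℓ)
      (fun ℓ _ => congrFun (toggleAt_of_ne g p (by omega)) ℓ)
      (fun ℓ _ => congrFun (toggleAt_of_ne g p (by omega)) ℓ)]

theorem IsStripChain.toggleAt_toggleAt (hg : IsStripChain r N r a c g)
    (hp : FirstViolation r g p) : Paper.toggleAt (Paper.toggleAt g p) p = g := by
  obtain ⟨-, -, hbox, hint⟩ := hg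
  funext k
  rcases eq_or_ne k (p.1 + 1) with rfl | hk
  · rw [toggleAt_self, toggleAt_of_ne _ _ (by omega), toggleAt_of_ne _ _ (by omega),
      toggleAt_self, partialToggle_partialToggle (hbox _) (hbox _) (hbox _) (hint _) (hint _)
      hp.1.2.2]
  · rw [toggleAt_of_ne _ _ hk, toggleAt_of_ne _ _ hk]

theorem IsStripChain.altWeight_toggleAt (hg : IsStripChain r N r a c g)
    (hp : FirstViolation r g p) (μ : ℕ → ℕ) :
    altWeight r μ (wt r (Paper.toggleAt g p)) = -altWeight r μ (wt r g) := by
  obtain ⟨-, -, hbox, hint⟩ := hg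
  have hk : p.1 + 1 < r := hp.1.1
  refine altWeight_swap μ (k := ⟨p.1, by omega⟩) (l := ⟨p.1 + 1, hk⟩) (by simp) fun i => ?_
  rw [Paper.toggleAt, wt_update g hk _ 1 (size_partialToggle (hbox _) (hbox _) (hbox _) (hint _)
    (hint _) hp.1.2.1 hp.1.2.2)]
  rcases eq_or_ne (i : ℕ) p.1 with h | h
  · rw [show i = ⟨p.1, by omega⟩ from Fin.ext h, Equiv.swap_apply_left]
    simp
    ring
  · rcases eq_or_ne (i : ℕ) (p.1 + 1) with h' | h'
    · rw [show i = ⟨p.1 + 1, by omega⟩ from Fin.ext h', Equiv.swap_apply_right]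
      simp
    · rw [Equiv.swap_apply_of_ne_of_ne (fun e => h (by simp [e])) (fun e => h' (by simp [e]))]
      simp [h, h']

theorem IsStripChain.antitone_wt (hg : IsStripChain r N r a c g) (hl : IsLattice r g) :
    Antitone (wt r g : Fin r → ℤ) := by
  cases r with
  | zero => exact Subsingleton.antitone _
  | succ n =>
    refine Fin.antitone_iff_succ_le.2 fun i => ?_
    have h := hl i (n + 1)
    have hi := i.2
    simp only [Violates, not_and, not_lt] at h
    have h := h (by omega) le_rfl
    have h' := (hg.2.2.2 i (n + 1)).1
    rw [excess, sum_sub_distrib, sum_sub_distrib] at h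
    simp only [wt, size, Fin.val_succ, Fin.val_castSucc]
    rw [sum_range_succ (fun ℓ => (g (i + 1) ℓ : ℤ)) (n + 1), sum_range_succ (fun ℓ => (g i ℓ : ℤ)) (n + 1)]
    rw [sum_range_succ (fun ℓ => (g (i + 1) ℓ : ℤ)) (n + 1)] at h
    rw [show (i : ℕ) + 1 + 1 = i + 2 from rfl]
    linarith [(Nat.cast_le (α := ℤ)).2 h']

end

open Classical in
/-- The signed count of chains of horizontal strips is the number of lattice chains. -/
theorem sum_altWeight {r N : ℕ} {a c μ : ℕ → ℕ} (hμ : Antitone μ) :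
    ∑ g ∈ stripChains r N r a c, altWeight r μ (wt r g) =
      #{g ∈ stripChains r N r a c | IsLattice r g ∧ ∀ i : Fin r, wt r g i = μ (i + 1)} := by
  have hbad : ∑ g ∈ stripChains r N r a c with ¬IsLattice r g, altWeight r μ (wt r g) = 0 := by
    have hex : ∀ g ∈ {g ∈ stripChains r N r a c | ¬IsLattice r g}, ∃ p, FirstViolation r g p :=
      fun g hg => exists_firstViolation (mem_filter.1 hg).2
    have hch : ∀ g ∈ {g ∈ stripChains r N r a c | ¬IsLattice r g}, IsStripChain r N r a c g :=
      fun g hg => mem_stripChains.1 (mem_filter.1 hg).1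
    refine sum_involution (fun g hg => toggleAt g (hex g hg).choose) (fun g hg => ?_)
      (fun g hg hne he => ?_) (fun g hg => ?_) (fun g hg => ?_)
    · rw [(hch g hg).altWeight_toggleAt (hex g hg).choose_spec, add_neg_cancel]
    · have := (hch g hg).altWeight_toggleAt (hex g hg).choose_spec μ
      rw [he] at this
      omega
    · have hp := (hex g hg).choose_spec
      have hv := ((hch g hg).firstViolation_toggleAt hp).1
      exact mem_filter.2 ⟨mem_stripChains.2 ((hch g hg).toggleAt hp), fun h => h _ _ hv⟩
    · have hp := (hex g hg).choose_spec
      generalize_proofs _ h2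
      rw [h2.choose_spec.unique ((hch g hg).firstViolation_toggleAt hp)]
      exact (hch g hg).toggleAt_toggleAt hp
  rw [← sum_filter_add_sum_filter_not _ (IsLattice r), hbad, add_zero, ← filter_filter,
    card_filter, Nat.cast_sum]
  refine sum_congr rfl fun g hg => ?_
  obtain ⟨hg, hl⟩ := mem_filter.1 hg
  rw [altWeight_of_antitone hμ ((mem_stripChains.1 hg).antitone_wt hl)]
  push_cast
  rfl

/-! ### Lattice chains and Littlewood–Richardson fillings -/

theorem IsStripChain.eq_of_isLattice {r N : ℕ} {a c : ℕ → ℕ} {g : ℕ → ℕ → ℕ}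
    (hg : IsStripChain r N r a c g) (hl : IsLattice r g) {k : ℕ} (hk : k < r) :
    ∀ ℓ ≤ k, g (k + 1) ℓ = g k ℓ := by
  obtain ⟨-, -, hbox, hint⟩ := hg
  induction k with
  | zero =>
    intro ℓ hℓ
    obtain rfl : ℓ = 0 := by omega
    rw [(hbox _).1, (hbox _).1]
  | succ k ih =>
    have h := hl k (k + 1)
    simp only [Violates, not_and, not_lt] at h
    have h := h hk hk.le
    have h0 : ∑ ℓ ∈ range (k + 1), ((g (k + 1) ℓ : ℤ) - g k ℓ) = 0 :=
      sum_eq_zero fun ℓ hℓ => by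
        rw [ih (by omega) ℓ (Nat.lt_succ_iff.1 (mem_range.1 hℓ)), sub_self]
    rw [excess, h0, sub_zero] at h
    have hnn : ∀ ℓ ∈ range (k + 1 + 1), (0 : ℤ) ≤ (g (k + 2) ℓ : ℤ) - g (k + 1) ℓ := fun ℓ _ => by
      have := (hint (k + 1) ℓ).1
      rw [show k + 1 + 1 = k + 2 from rfl] at this
      omega
    intro ℓ hℓ
    have := (sum_eq_zero_iff_of_nonneg hnn).1 (le_antisymm h (sum_nonneg hnn)) ℓ
      (mem_range.2 (by omega))
    rw [show k + 1 + 1 = k + 2 from rfl]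
    omega

/-- The empty partition, as a boxed partition. -/
def emptyBox (N ℓ : ℕ) : ℕ := if ℓ = 0 then N else 0

/-- The chain adding the rows of `κ` one by one. -/
def rowChain (κ : ℕ → ℕ) (k ℓ : ℕ) : ℕ := if ℓ ≤ k then κ ℓ else 0

section

variable {r N : ℕ} {κ : ℕ → ℕ}

theorem rowChain_succ_sub (k ℓ : ℕ) :
    (rowChain κ (k + 1) ℓ : ℤ) - rowChain κ k ℓ = if ℓ = k + 1 then (κ ℓ : ℤ) else 0 := by
  simp only [rowChain]
  split_ifs <;> omega

theorem isStripChain_rowChain (hκ : IsBox r N κ) :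
    IsStripChain r N r (emptyBox N) κ (rowChain κ) := by
  refine ⟨funext fun ℓ => ?_, fun k hk => funext fun ℓ => ?_, fun k => ⟨?_, fun i j hij => ?_,
    fun ℓ hℓ => ?_⟩, fun k ℓ => ⟨?_, ?_⟩⟩
  · rcases eq_or_ne ℓ 0 with rfl | h
    · simp [rowChain, emptyBox, hκ.1]
    · simp [rowChain, emptyBox, h]
  · rcases Nat.lt_or_ge r ℓ with h | h
    · simp [rowChain, hκ.2.2 ℓ h]
    · simp [rowChain, h.trans hk]
  · simp [rowChain, hκ.1]
  · have := hκ.2.1 hij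
    simp only [rowChain]
    split_ifs <;> omega
  · simp [rowChain, hκ.2.2 ℓ hℓ]
  · simp only [rowChain]
    split_ifs <;> omega
  · have := hκ.2.1 ℓ.le_succ
    simp only [rowChain]
    split_ifs <;> omega

theorem isLattice_rowChain (hκ : Antitone κ) : IsLattice r (rowChain κ) := by
  rintro k L ⟨-, -, h⟩
  have h1 : κ (k + 1 + 1) ≤ κ (k + 1) := hκ (k + 1).le_succ
  simp only [excess, rowChain_succ_sub, sum_ite_eq', mem_range] at h
  split_ifs at h <;> omega

theorem wt_rowChain (i : Fin r) : wt r (rowChain κ) i = κ (i + 1) := by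
  rw [wt, size, size, ← sum_sub_distrib]
  simp [rowChain_succ_sub]

theorem IsStripChain.eq_rowChain {g : ℕ → ℕ → ℕ} (hg : IsStripChain r N r (emptyBox N) κ g)
    (hl : IsLattice r g) : g = rowChain κ := by
  have hz : ∀ k ℓ, k < ℓ → g k ℓ = 0 := by
    intro k
    induction k with
    | zero =>
      intro ℓ hℓ
      rw [hg.1, emptyBox, if_neg (by omega)]
    | succ k ih =>
      intro ℓ hℓ
      obtain ⟨ℓ, rfl⟩ : ∃ m, ℓ = m + 1 := ⟨ℓ - 1, by omega⟩
      have := (hg.2.2.2 k ℓ).2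
      rw [ih ℓ (by omega)] at this
      omega
  have hc : ∀ n k ℓ, r ≤ k + n → ℓ ≤ k → g k ℓ = κ ℓ := by
    intro n
    induction n with
    | zero => exact fun k ℓ hk _ => congrFun (hg.2.1 k hk) ℓ
    | succ n ih =>
      intro k ℓ hk hℓ
      rcases Nat.lt_or_ge k r with h | h
      · rw [← hg.eq_of_isLattice hl h ℓ hℓ, ih (k + 1) ℓ (by omega) (by omega)]
      · exact congrFun (hg.2.1 k h) ℓ
  funext k ℓ
  rw [rowChain]
  split_ifs with h
  · exact hc r k ℓ (by omega) h
  · exact hz k ℓ (by omega)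

open Classical in
theorem sum_altWeight_emptyBox {μ : ℕ → ℕ} (hκ : IsBox r N κ) (hμ : IsBox r N μ) :
    ∑ g ∈ stripChains r N r (emptyBox N) κ, altWeight r μ (wt r g) = if κ = μ then 1 else 0 := by
  rw [sum_altWeight hμ.2.1]
  have key : ∀ g ∈ stripChains r N r (emptyBox N) κ, IsLattice r g →
      (∀ i : Fin r, wt r g i = μ (i + 1)) → κ = μ := by
    intro g hg hl hw
    obtain rfl := (mem_stripChains.1 hg).eq_rowChain hl
    funext ℓ
    cases ℓ with
    | zero => rw [hκ.1, hμ.1]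
    | succ ℓ =>
      rcases Nat.lt_or_ge ℓ r with h | h
      · have := hw ⟨ℓ, h⟩
        rw [wt_rowChain] at this
        exact_mod_cast this
      · rw [hκ.2.2 _ (by omega), hμ.2.2 _ (by omega)]
  split_ifs with h
  · subst h
    rw [Nat.cast_eq_one, card_eq_one]
    refine ⟨rowChain κ, eq_singleton_iff_unique_mem.2 ⟨mem_filter.2
      ⟨mem_stripChains.2 (isStripChain_rowChain hκ), isLattice_rowChain hκ.2.1, wt_rowChain⟩,
      fun g hg => ?_⟩⟩
    obtain ⟨hg, hl, -⟩ := mem_filter.1 hg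
    exact (mem_stripChains.1 hg).eq_rowChain hl
  · rw [Nat.cast_eq_zero, card_eq_zero, filter_eq_empty_iff]
    exact fun g hg hl => h (key g hg hl.1 hl.2)

end

theorem sum_altWeight_comm {r N : ℕ} {lam mu : ℕ → ℕ} (nu : ℕ → ℕ) (hlam : IsBox r N lam)
    (hmu : IsBox r N mu) :
    ∑ g ∈ stripChains r N r lam nu, altWeight r mu (wt r g) =
      ∑ g ∈ stripChains r N r mu nu, altWeight r lam (wt r g) := by
  classical
  have key : ∀ {lam mu : ℕ → ℕ}, IsBox r N lam →
      ∑ g ∈ stripChains r N r lam nu, altWeight r mu (wt r g) =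
        ∑ g ∈ stripChains r N (r + r) (emptyBox N) nu,
          altWeight r lam (fun i => wt r g (Fin.castAdd r i)) *
            altWeight r mu (fun i => wt r g (Fin.natAdd r i)) := by
    intro lam mu hlam
    rw [sum_stripChains_add (altWeight r lam) (altWeight r mu), sum_eq_single lam]
    · rw [sum_altWeight_emptyBox hlam hlam, if_pos rfl, one_mul]
    · intro κ hκ hne
      rw [sum_altWeight_emptyBox (mem_boxes.1 hκ) hlam, if_neg hne, zero_mul]
    · exact fun h => absurd (mem_boxes.2 hlam) h
  rw [key hlam, key hmu, sum_stripChains_perm (emptyBox N) nu finAddFlip fun w =>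
    altWeight r lam (fun i => w (Fin.castAdd r i)) * altWeight r mu (fun i => w (Fin.natAdd r i))]
  refine sum_congr rfl fun g _ => ?_
  rw [mul_comm]
  simp only [Function.comp_apply, finAddFlip_apply_castAdd, finAddFlip_apply_natAdd]

theorem sum_Icc_one (F : ℕ → ℕ) (n : ℕ) : ∑ k ∈ Icc 1 n, F k = ∑ j ∈ range n, F (j + 1) := by
  induction n with
  | zero => rfl
  | succ n ih => rw [sum_Icc_succ_top (by omega), ih, sum_range_succ]

theorem sum_Icc_of_eq_zero {F : ℕ → ℕ} {k : ℕ} (h : ∀ ℓ < k, F ℓ = 0) (p : ℕ) :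
    ∑ ℓ ∈ Icc k p, F ℓ = ∑ ℓ ∈ range (p + 1), F ℓ := by
  refine sum_subset (fun ℓ hℓ => ?_) fun ℓ _ hℓ => h ℓ ?_
  · have := mem_Icc.1 hℓ
    exact mem_range.2 (by omega)
  · simp_all

/-- The chain of partitions obtained by successively adding the entries `1, 2, …` of a
filling. -/
def fillingChain (a : ℕ → ℕ) (f : ℕ → ℕ → ℕ) (k ℓ : ℕ) : ℕ := a ℓ + ∑ j ∈ range k, f (j + 1) ℓ

theorem fillingChain_succ (a : ℕ → ℕ) (f : ℕ → ℕ → ℕ) (k ℓ : ℕ) :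
    fillingChain a f (k + 1) ℓ = fillingChain a f k ℓ + f (k + 1) ℓ := by
  rw [fillingChain, sum_range_succ, fillingChain, add_assoc]

section

variable {r N : ℕ} {a c μ : ℕ → ℕ} {f : ℕ → ℕ → ℕ}

theorem wt_fillingChain (i : Fin r) :
    wt r (fillingChain a f) i = ∑ ℓ ∈ range (r + 1), f (i + 1) ℓ := by
  rw [wt, size, size, ← sum_sub_distrib]
  push_cast
  refine sum_congr rfl fun ℓ _ => ?_
  rw [fillingChain_succ]
  push_cast
  ring

theorem excess_fillingChain (k L : ℕ) :
    excess (fillingChain a f k) (fillingChain a f (k + 1)) (fillingChain a f (k + 2)) L =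
      (∑ ℓ ∈ range (L + 1), f (k + 2) ℓ : ℕ) - (∑ ℓ ∈ range L, f (k + 1) ℓ : ℕ) := by
  rw [excess]
  push_cast
  congr 1 <;> refine sum_congr rfl fun ℓ _ => ?_
  · rw [fillingChain_succ a f (k + 1)]
    push_cast
    ring
  · rw [fillingChain_succ]
    push_cast
    ring

theorem IsFilling.fillingChain_of_le (hf : IsFilling r a μ c f) (ha : IsBox r N a)
    (hc : IsBox r N c) {k ℓ : ℕ} (h : r ≤ k ∨ ℓ ≤ k) : fillingChain a f k ℓ = c ℓ := by
  obtain ⟨h0, hrow, -⟩ := hf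
  rcases Nat.eq_zero_or_pos ℓ with rfl | hℓ
  · rw [fillingChain, sum_eq_zero fun j _ => h0 _ _ (by omega), ha.1, hc.1, add_zero]
  · rcases Nat.lt_or_ge r ℓ with hr | hr
    · rw [fillingChain, sum_eq_zero fun j _ => h0 _ _ (by omega), ha.2.2 ℓ hr, hc.2.2 ℓ hr, add_zero]
    · rw [← hrow ℓ hℓ hr, sum_Icc_one, fillingChain]
      congr 1
      refine (sum_subset (range_subset_range.2 (by omega)) fun j _ hj => h0 _ _ ?_).symm
      have := mem_range.not.1 hj
      omega

theorem fillingChain_mono {k k' : ℕ} (h : k ≤ k') (ℓ : ℕ) :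
    fillingChain a f k ℓ ≤ fillingChain a f k' ℓ :=
  Nat.add_le_add_left (sum_le_sum_of_subset (range_subset_range.2 h)) _

theorem IsFilling.isStripChain (hf : IsFilling r a μ c f) (ha : IsBox r N a)
    (hc : IsBox r N c) : IsStripChain r N r a c (fillingChain a f) := by
  have hle : ∀ k ℓ, fillingChain a f k ℓ ≤ c ℓ := fun k ℓ => by
    rw [← hf.fillingChain_of_le ha hc (Or.inl (le_max_left r k))]
    exact fillingChain_mono (le_max_right r k) ℓ
  have hint : ∀ k, Interlace (fillingChain a f k) (fillingChain a f (k + 1)) := by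
    refine fun k ℓ => ⟨fillingChain_mono k.le_succ ℓ, ?_⟩
    rcases Nat.lt_or_ge k ℓ with hk | hk
    · rcases Nat.lt_or_ge ℓ r with hr | hr
      · simpa only [fillingChain, sum_Icc_one] using hf.2.2.2.1 k ℓ hk hr
      · refine (hle _ _).trans ?_
        rw [hc.2.2 _ (by omega)]
        exact Nat.zero_le _
    · rw [hf.fillingChain_of_le ha hc (Or.inr hk)]
      exact (hle _ _).trans (hc.2.1 ℓ.le_succ)
  have h0 : fillingChain a f 0 = a := by
    funext ℓ
    simp [fillingChain]
  refine ⟨h0, fun k hk => funext fun ℓ => hf.fillingChain_of_le ha hc (Or.inl hk), fun k => ?_,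
    hint⟩
  induction k with
  | zero => rwa [h0]
  | succ k ih =>
    refine ⟨le_antisymm ((hle _ _).trans hc.1.le)
      (ih.1.ge.trans (fillingChain_mono k.le_succ 0)), antitone_nat_of_succ_le fun ℓ =>
        ((hint k ℓ).2.trans (hint k ℓ).1), fun ℓ hℓ => Nat.eq_zero_of_le_zero ?_⟩
    exact (hle _ _).trans (hc.2.2 ℓ hℓ).le

theorem IsFilling.isLattice (hf : IsFilling r a μ c f) : IsLattice r (fillingChain a f) := by
  rintro k L ⟨hk, hL, h⟩
  obtain ⟨h0, -, -, -, hlat⟩ := hf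
  rw [excess_fillingChain] at h
  rcases Nat.lt_or_ge (k + 1) L with hkL | hkL
  · obtain ⟨p, rfl⟩ : ∃ p, L = p + 1 := ⟨L - 1, by omega⟩
    have := hlat (k + 1) p (by omega) (by omega) (by omega)
    rw [sum_Icc_of_eq_zero fun ℓ hℓ => h0 _ _ (by omega),
      sum_Icc_of_eq_zero fun ℓ hℓ => h0 _ _ (by omega)] at this
    rw [show k + 1 + 1 = k + 2 from rfl] at this
    omega
  · rw [sum_eq_zero fun ℓ hℓ => h0 (k + 2) ℓ (by have := mem_range.1 hℓ; omega)] at h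
    omega

/-- The filling recorded by a chain of partitions. -/
def chainFilling (g : ℕ → ℕ → ℕ) (k ℓ : ℕ) : ℕ := g k ℓ - g (k - 1) ℓ

theorem IsStripChain.fillingChain_chainFilling {g : ℕ → ℕ → ℕ} (hg : IsStripChain r N r a c g) :
    fillingChain a (chainFilling g) = g := by
  funext k ℓ
  induction k with
  | zero => simp [fillingChain, hg.1]
  | succ k ih =>
    have := (hg.2.2.2 k ℓ).1
    rw [fillingChain_succ, ih, chainFilling, Nat.add_sub_cancel]
    omega

theorem chainFilling_fillingChain (hf : ∀ ℓ, f 0 ℓ = 0) :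
    chainFilling (fillingChain a f) = f := by
  funext k ℓ
  cases k with
  | zero => simp [chainFilling, hf]
  | succ k =>
    rw [chainFilling, fillingChain_succ]
    simp

theorem IsStripChain.isFilling {g : ℕ → ℕ → ℕ} (hg : IsStripChain r N r a c g)
    (hl : IsLattice r g) (hw : ∀ i : Fin r, wt r g i = μ (i + 1)) :
    IsFilling r a μ c (chainFilling g) := by
  have hinv := hg.fillingChain_chainFilling
  set f := chainFilling g with hf
  have htri : ∀ k ℓ : ℕ, (k < 1 ∨ ℓ < k ∨ r < ℓ) → f k ℓ = 0 := by
    intro k ℓ h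
    cases k with
    | zero => simp [hf, chainFilling]
    | succ k =>
      rw [hf, chainFilling, Nat.add_sub_cancel]
      rcases Nat.lt_or_ge k r with hk | hk
      · rcases Nat.lt_or_ge r ℓ with hr | hr
        · rw [(hg.2.2.1 _).2.2 ℓ hr, Nat.zero_sub]
        · rw [hg.eq_of_isLattice hl hk ℓ (by omega), Nat.sub_self]
      · rw [hg.2.1 _ (by omega), hg.2.1 _ hk, Nat.sub_self]
  refine ⟨htri, fun ℓ h1 hr => ?_, fun k h1 hr => ?_, fun p ℓ hp hr => ?_, fun k p h1 hkp hp => ?_⟩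
  · rw [← hg.2.1 r le_rfl, ← hinv, sum_Icc_one, fillingChain]
    congr 1
    refine sum_subset (range_subset_range.2 hr) fun j _ hj => htri _ _ ?_
    have := mem_range.not.1 hj
    omega
  · obtain ⟨i, rfl⟩ : ∃ i, k = i + 1 := ⟨k - 1, by omega⟩
    have := hw ⟨i, by omega⟩
    rw [← hinv, wt_fillingChain] at this
    rw [sum_Icc_of_eq_zero fun ℓ hℓ => htri _ _ (by omega)]
    exact_mod_cast this
  · have := (hg.2.2.2 p ℓ).2
    rw [← hinv] at this
    simpa only [fillingChain, sum_Icc_one] using this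
  · obtain ⟨i, rfl⟩ : ∃ i, k = i + 1 := ⟨k - 1, by omega⟩
    have := hl i (p + 1)
    rw [← hinv, Violates, excess_fillingChain] at this
    rw [sum_Icc_of_eq_zero fun ℓ hℓ => htri _ _ (by omega),
      sum_Icc_of_eq_zero fun ℓ hℓ => htri _ _ (by omega)]
    rw [show i + 1 + 1 = i + 2 from rfl]
    omega

/-- The Littlewood–Richardson coefficient as a signed count of chains of horizontal strips. -/
theorem LRcoeff_eq_sum_altWeight (ha : IsBox r N a) (hc : IsBox r N c) (hμ : Antitone μ) :
    (LRcoeff r a μ c : ℤ) = ∑ g ∈ stripChains r N r a c, altWeight r μ (wt r g) := by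
  classical
  rw [sum_altWeight hμ, LRcoeff, Nat.cast_inj, ← Nat.subtype_card _ fun g => mem_filter]
  refine Nat.card_congr
    { toFun := fun f => ⟨fillingChain a f.1, mem_stripChains.2 (f.2.isStripChain ha hc),
        f.2.isLattice, fun i => ?_⟩
      invFun := fun g => ⟨chainFilling g.1, (mem_stripChains.1 g.2.1).isFilling g.2.2.1 g.2.2.2⟩
      left_inv := fun f => Subtype.ext (chainFilling_fillingChain fun ℓ => f.2.1 0 ℓ (by omega))
      right_inv := fun g => Subtype.ext (mem_stripChains.1 g.2.1).fillingChain_chainFilling }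
  obtain ⟨h0, -, hcont, -⟩ := f.2
  have := hcont (i + 1) (by omega) (by omega)
  rw [sum_Icc_of_eq_zero fun ℓ hℓ => h0 _ _ (by omega)] at this
  rw [wt_fillingChain, ← this]

end

/-! ### Permuting the arguments -/

theorem IsFilling.congr {r : ℕ} {a a' μ μ' c c' : ℕ → ℕ} {f : ℕ → ℕ → ℕ}
    (hf : IsFilling r a μ c f) (ha : ∀ ℓ, 1 ≤ ℓ → ℓ ≤ r → a ℓ = a' ℓ)
    (hμ : ∀ ℓ, 1 ≤ ℓ → ℓ ≤ r → μ ℓ = μ' ℓ) (hc : ∀ ℓ, 1 ≤ ℓ → ℓ ≤ r → c ℓ = c' ℓ) :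
    IsFilling r a' μ' c' f := by
  obtain ⟨h0, hrow, hcont, hshape, hlat⟩ := hf
  refine ⟨h0, fun ℓ h1 h2 => ?_, fun k h1 h2 => ?_, fun p ℓ h1 h2 => ?_, hlat⟩
  · rw [← ha ℓ h1 h2, ← hc ℓ h1 h2, hrow ℓ h1 h2]
  · rw [← hμ k h1 h2, hcont k h1 h2]
  · rw [← ha ℓ (by omega) h2.le, ← ha (ℓ + 1) (by omega) h2]
    exact hshape p ℓ h1 h2

theorem LRcoeff_congr {r : ℕ} {a a' μ μ' c c' : ℕ → ℕ} (ha : ∀ ℓ, 1 ≤ ℓ → ℓ ≤ r → a ℓ = a' ℓ)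
    (hμ : ∀ ℓ, 1 ≤ ℓ → ℓ ≤ r → μ ℓ = μ' ℓ) (hc : ∀ ℓ, 1 ≤ ℓ → ℓ ≤ r → c ℓ = c' ℓ) :
    LRcoeff r a μ c = LRcoeff r a' μ' c' :=
  Nat.card_congr (Equiv.subtypeEquivRight fun _ => ⟨fun hf => hf.congr ha hμ hc, fun hf =>
    hf.congr (fun ℓ h1 h2 => (ha ℓ h1 h2).symm) (fun ℓ h1 h2 => (hμ ℓ h1 h2).symm)
      fun ℓ h1 h2 => (hc ℓ h1 h2).symm⟩)

theorem elem_succ {I : Finset ℕ} {p : ℕ} (hp : p < I.card) :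
    elem I (p + 1) = I.orderEmbOfFin rfl ⟨p, hp⟩ := by
  rw [elem, if_neg p.succ_ne_zero, Nat.add_sub_cancel, List.getD_eq_getElem _ _ (by simpa using hp)]
  rfl

theorem elem_lt_elem_succ {I : Finset ℕ} {p : ℕ} (hpr : p + 1 < I.card) :
    elem I (p + 1) < elem I (p + 1 + 1) := by
  rw [elem_succ (by omega), elem_succ hpr]
  exact (I.orderEmbOfFin rfl).strictMono (Fin.mk_lt_mk.2 p.lt_succ_self)

theorem elem_succ_mem {I : Finset ℕ} {p : ℕ} (hp : p < I.card) : elem I (p + 1) ∈ I := by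
  rw [elem_succ hp]
  exact orderEmbOfFin_mem _ _ _

theorem elem_bounds {n : ℕ} {I : Finset ℕ} (hI : I ⊆ Icc 1 n) {p : ℕ} (hp : 1 ≤ p)
    (hpr : p ≤ I.card) : p ≤ elem I p ∧ elem I p + I.card ≤ n + p := by
  obtain ⟨p, rfl⟩ : ∃ q, p = q + 1 := ⟨p - 1, by omega⟩
  constructor
  · clear hp
    induction p with
    | zero => exact (mem_Icc.1 (hI (elem_succ_mem hpr))).1
    | succ p ih =>
      have := ih (by omega)
      have := elem_lt_elem_succ hpr
      omega
  · obtain ⟨m, hm⟩ := Nat.exists_eq_add_of_le hpr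
    induction m generalizing p with
    | zero =>
      have := (mem_Icc.1 (hI (elem_succ_mem hpr))).2
      omega
    | succ m ih =>
      have := ih (p + 1) (by omega) (by omega) (by omega)
      have := elem_lt_elem_succ (I := I) (p := p) (by omega)
      omega

/-- The partition `ρ_r(σₙ(I))` as a boxed partition. -/
def boxOf (n : ℕ) (I : Finset ℕ) : ℕ → ℕ := Function.update (lamOf n I.card I) 0 (n - I.card)

theorem isBox_boxOf {n : ℕ} {I : Finset ℕ} (hI : I ⊆ Icc 1 n) :
    IsBox I.card (n - I.card) (boxOf n I) := by
  refine ⟨Function.update_self _ _ _, antitone_nat_of_succ_le fun ℓ => ?_, fun ℓ hℓ => ?_⟩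
  · rw [boxOf, Function.update_of_ne ℓ.succ_ne_zero, lamOf]
    split_ifs with h
    · have h1 := elem_bounds hI h.1 h.2
      cases ℓ with
      | zero =>
        rw [Function.update_self]
        omega
      | succ ℓ =>
        have h2 : elem I (ℓ + 1) < elem I (ℓ + 1 + 1) := elem_lt_elem_succ h.2
        rw [Function.update_of_ne ℓ.succ_ne_zero, lamOf, if_pos (by omega)]
        simp only [Nat.succ_eq_add_one] at h1 ⊢
        omega
    · exact Nat.zero_le _
  · rw [boxOf, Function.update_of_ne (by omega), lamOf, if_neg (by omega)]

theorem cIJK_eq_sum {n r : ℕ} {I J K : Finset ℕ} (hI : I ⊆ Icc 1 n) (hJ : J ⊆ Icc 1 n)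
    (hK : K ⊆ Icc 1 n) (hIc : I.card = r) (hJc : J.card = r) (hKc : K.card = r) :
    (cIJK n I J K : ℤ) =
      ∑ g ∈ stripChains r (n - r) r (boxOf n I) (boxCompl r (n - r) (boxOf n K)),
        altWeight r (boxOf n J) (wt r g) := by
  have hI' := isBox_boxOf hI
  have hJ' := isBox_boxOf hJ
  have hK' := isBox_boxOf hK
  rw [hIc] at hI'
  rw [hJc] at hJ'
  rw [hKc] at hK'
  rw [← LRcoeff_eq_sum_altWeight hI' hK'.boxCompl hJ'.2.1, cIJK, hIc, Nat.cast_inj]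
  refine LRcoeff_congr (fun ℓ h1 _ => ?_) (fun ℓ h1 _ => ?_) fun ℓ h1 h2 => ?_
  · rw [boxOf, Function.update_of_ne (by omega), hIc]
  · rw [boxOf, Function.update_of_ne (by omega), hJc]
  · have := elem_bounds hK (p := r + 1 - ℓ) (by omega) (by omega)
    rw [nuOf, if_pos ⟨h1, h2⟩, boxCompl, boxOf, Function.update_of_ne (by omega), hKc, lamOf,
      if_pos (by omega)]
    omega

theorem cIJK_swap_left {n r : ℕ} {I J K : Finset ℕ} (hI : I ⊆ Icc 1 n) (hJ : J ⊆ Icc 1 n)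
    (hK : K ⊆ Icc 1 n) (hIc : I.card = r) (hJc : J.card = r) (hKc : K.card = r) :
    cIJK n I J K = cIJK n J I K := by
  have h := sum_altWeight_comm (boxCompl r (n - r) (boxOf n K)) (hIc ▸ isBox_boxOf hI)
    (hJc ▸ isBox_boxOf hJ)
  rw [← cIJK_eq_sum hI hJ hK hIc hJc hKc, ← cIJK_eq_sum hJ hI hK hJc hIc hKc] at h
  exact_mod_cast h

theorem cIJK_swap_outer {n r : ℕ} {I J K : Finset ℕ} (hI : I ⊆ Icc 1 n) (hJ : J ⊆ Icc 1 n)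
    (hK : K ⊆ Icc 1 n) (hIc : I.card = r) (hJc : J.card = r) (hKc : K.card = r) :
    cIJK n I J K = cIJK n K J I := by
  have hK' : IsBox r (n - r) (boxOf n K) := hKc ▸ isBox_boxOf hK
  have h := sum_stripChains_boxCompl (M := r) (hIc ▸ isBox_boxOf hI) hK'.boxCompl
    (altWeight r (boxOf n J))
  rw [boxCompl_boxCompl hK', ← cIJK_eq_sum hI hJ hK hIc hJc hKc,
    ← cIJK_eq_sum hK hJ hI hKc hJc hIc] at h
  exact_mod_cast h

end Paper

/-- The Littlewood–Richardson coefficient `c⁽ⁿ⁾(I,J,K)` of a triple of `r`-element subsets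
of `{1,…,n}` is invariant under all permutations of the three arguments `I`, `J`, `K`. -/
theorem cIJK_perm_invariant (n r : ℕ) (hr : r ≤ n) (I J K : Finset ℕ)
    (hI : I ⊆ Finset.Icc 1 n) (hJ : J ⊆ Finset.Icc 1 n) (hK : K ⊆ Finset.Icc 1 n)
    (hIc : I.card = r) (hJc : J.card = r) (hKc : K.card = r) :
    Paper.cIJK n I J K = Paper.cIJK n J I K ∧
    Paper.cIJK n I J K = Paper.cIJK n I K J ∧
    Paper.cIJK n I J K = Paper.cIJK n K J I ∧
    Paper.cIJK n I J K = Paper.cIJK n J K I ∧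
    Paper.cIJK n I J K = Paper.cIJK n K I J := by
  have hIJ := Paper.cIJK_swap_left hI hJ hK hIc hJc hKc
  have hIK := Paper.cIJK_swap_outer hI hJ hK hIc hJc hKc
  have hKI := Paper.cIJK_swap_left hK hJ hI hKc hJc hIc
  have hJK := Paper.cIJK_swap_outer hJ hI hK hJc hIc hKc
  have hlast := Paper.cIJK_swap_left hK hI hJ hKc hIc hJc
  exact ⟨hIJ, by rw [hIJ, hJK, hlast], hIK, by rw [hIK, hKI], by rw [hIJ, hJK]⟩
end
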